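/- arXiv:2605.23517 — 8 statements merged into one kernel-verified Lean document; each statement's English description precedes it below -/
import Mathlib

section
/- There is a constant c with 0 < c < 1 such that for every natural number k there exists a satisfiable ETR-INV instance φ over a variable set V with n ≥ 2 variables with the following property: for every assignment f : V → [1/2, 2] that satisfies at least a c fraction of the constraints of φ, there is some variable v ∈ V such that the field extension ℚ(f(v))/ℚ has degree greater than n^k (i.e., f(v) is not algebraic of degree ≤ n^k over ℚ). -/
open scoped Classical

/-- An ETR-INV constraint over a variable set `V`: `x = 1`, `x·y = 1`, or `x + y = z`. -/
inductive EtrInv (V : Type) : Type where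
  | one : V → EtrInv V
  | inv : V → V → EtrInv V
  | add : V → V → V → EtrInv V

/-- Satisfaction of an ETR-INV constraint by an assignment `f`. -/
def EtrInv.Sat {V : Type} (f : V → ℝ) : EtrInv V → Prop
  | .one x => f x = 1
  | .inv x y => f x * f y = 1
  | .add x y z => f x + f y = f z

/-- An assignment taking values in `[1/2, 2]`. -/
def InRange {V : Type} (f : V → ℝ) : Prop := ∀ v, f v ∈ Set.Icc (1/2 : ℝ) 2

/-- The proportion of elements of a finite type that satisfy `P`. -/
noncomputable def dens {α : Type*} [Fintype α] (P : α → Prop) : ℝ :=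
  ((Finset.univ.filter P).card : ℝ) / Fintype.card α

theorem dens_nonneg {α : Type*} [Fintype α] (P : α → Prop) : 0 ≤ dens P := by
  unfold dens; positivity

theorem dens_mono {α : Type*} [Fintype α] {P Q : α → Prop} (h : ∀ x, P x → Q x) :
    dens P ≤ dens Q := by
  refine div_le_div_of_nonneg_right ?_ (Nat.cast_nonneg _)
  exact_mod_cast Finset.card_le_card (Finset.monotone_filter_right _ fun x _ => h x)

theorem dens_le_add {α : Type*} [Fintype α] {P Q R : α → Prop} (h : ∀ x, R x → P x ∨ Q x) :
    dens R ≤ dens P + dens Q := by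
  unfold dens
  rw [← add_div]
  refine div_le_div_of_nonneg_right ?_ (Nat.cast_nonneg _)
  have hsub : Finset.univ.filter R ⊆ Finset.univ.filter P ∪ Finset.univ.filter Q :=
    fun x hx => by simpa using h x (by simpa using hx)
  exact_mod_cast (Finset.card_le_card hsub).trans (Finset.card_union_le _ _)

theorem dens_or_le {α : Type*} [Fintype α] (P Q : α → Prop) :
    dens (fun x => P x ∨ Q x) ≤ dens P + dens Q :=
  dens_le_add fun _ h => h

theorem exists_not_of_dens_lt_one {α : Type*} [Fintype α] [Nonempty α] {P : α → Prop}
    (h : dens P < 1) : ∃ x, ¬ P x := by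
  by_contra! hP
  have hcard : (0 : ℝ) < Fintype.card α := by exact_mod_cast Fintype.card_pos
  have : dens P = 1 := by
    unfold dens
    rw [Finset.filter_true_of_mem (fun x _ => hP x), Finset.card_univ, div_self hcard.ne']
  exact h.ne this

/-- Pulling a property back along a map whose fibres are indexed by `γ`. -/
theorem dens_comp_le {α β γ : Type*} [Fintype α] [Fintype β] [Fintype γ] (P : α → Prop)
    (f : β → α) (g : β → γ) (hfg : Function.Injective fun x => (f x, g x)) {C : ℝ} (hC₀ : 0 ≤ C)
    (hC : (Fintype.card γ : ℝ) * Fintype.card α ≤ C * Fintype.card β) :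
    dens (fun x => P (f x)) ≤ C * dens P := by
  rcases isEmpty_or_nonempty β with hβ | hβ
  · have : dens (fun x => P (f x)) = 0 := by simp [dens]
    rw [this]
    exact mul_nonneg hC₀ (dens_nonneg P)
  have hα : Nonempty α := hβ.map f
  have hαc : (0 : ℝ) < Fintype.card α := by exact_mod_cast Fintype.card_pos
  have hβc : (0 : ℝ) < Fintype.card β := by exact_mod_cast Fintype.card_pos
  have hcard : ((Finset.univ.filter fun x => P (f x)).card : ℝ) ≤
      (Finset.univ.filter P).card * Fintype.card γ := by
    have h : (Finset.univ.filter fun x => P (f x)).card ≤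
        ((Finset.univ.filter P) ×ˢ (Finset.univ : Finset γ)).card := by
      refine Finset.card_le_card_of_injOn (fun x => (f x, g x)) ?_ hfg.injOn
      intro x hx
      simpa using hx
    rw [Finset.card_product, Finset.card_univ] at h
    exact_mod_cast h
  unfold dens
  rw [div_le_iff₀ hβc]
  calc _ ≤ _ := hcard
    _ = (Finset.univ.filter P).card / Fintype.card α * (Fintype.card γ * Fintype.card α) := by
      field_simp
    _ ≤ (Finset.univ.filter P).card / Fintype.card α * (C * Fintype.card β) := by gcongr
    _ = _ := by ring

theorem dens_prod_mul_card {α β : Type*} [Fintype α] [Fintype β] (P : α × β → Prop) :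
    dens P * Fintype.card α = ∑ a, dens fun b => P (a, b) := by
  rcases isEmpty_or_nonempty α with hα | hα
  · simp
  have hαc : (Fintype.card α : ℝ) ≠ 0 := by exact_mod_cast Fintype.card_ne_zero
  simp only [dens, Finset.card_filter, Fintype.sum_prod_type, Fintype.card_prod]
  rw [← Finset.sum_div]
  push_cast
  field_simp

theorem dens_fst {α β : Type*} [Fintype α] [Fintype β] [Nonempty β] (P : α → Prop) :
    dens (fun x : α × β => P x.1) = dens P := by
  rcases isEmpty_or_nonempty α with hα | hα
  · simp [dens]
  have hαc : (Fintype.card α : ℝ) ≠ 0 := by exact_mod_cast Fintype.card_ne_zero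
  have hβc : (Fintype.card β : ℝ) ≠ 0 := by exact_mod_cast Fintype.card_ne_zero
  rw [← mul_left_inj' hαc, dens_prod_mul_card]
  simp only [dens, Finset.filter_const, Finset.card_filter P]
  push_cast
  rw [div_mul_cancel₀ _ hαc]
  refine Finset.sum_congr rfl fun a _ => ?_
  split_ifs <;> simp [hβc]

theorem dens_snd {α β : Type*} [Fintype α] [Fintype β] [Nonempty α] (P : β → Prop) :
    dens (fun x : α × β => P x.2) = dens P := by
  have hαc : (Fintype.card α : ℝ) ≠ 0 := by exact_mod_cast Fintype.card_ne_zero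
  rw [← mul_left_inj' hαc, dens_prod_mul_card]
  simp [mul_comm]

/-- Markov's inequality for the densities of the slices of a property of pairs. -/
theorem dens_slice_gt_mul_le {α β : Type*} [Fintype α] [Fintype β] (P : α × β → Prop) (η : ℝ) :
    dens (fun a => η < dens fun b => P (a, b)) * η ≤ dens P := by
  rcases isEmpty_or_nonempty α with hα | hα
  · simp [dens]
  have hαc : (0 : ℝ) < Fintype.card α := by exact_mod_cast Fintype.card_pos
  rw [← mul_le_mul_iff_left₀ hαc, dens_prod_mul_card, dens, Finset.card_filter]
  push_cast
  rw [mul_right_comm, div_mul_cancel₀ _ hαc.ne', Finset.sum_mul]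
  refine Finset.sum_le_sum fun a _ => ?_
  split_ifs with h
  · simpa using h.le
  · simpa using dens_nonneg _

theorem exists_dens_slice_le {α β : Type*} [Fintype α] [Fintype β] [Nonempty β]
    (P : α × β → Prop) : ∃ b, (dens fun a => P (a, b)) ≤ dens P := by
  by_contra! h
  have hβ₀ : (0 : ℝ) ≤ Fintype.card β := Nat.cast_nonneg _
  have hinj : Function.Injective fun x : β × α => ((x.2, x.1), ()) :=
    fun x y hxy => Prod.swap_injective (congrArg Prod.fst hxy)
  have hswap := dens_comp_le P (fun x : β × α => (x.2, x.1)) (fun _ => ()) hinj zero_le_one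
    (by simp [mul_comm])
  have hlt : ∑ _b : β, dens P < ∑ b, dens fun a => P (a, b) :=
    Finset.sum_lt_sum_of_nonempty Finset.univ_nonempty fun b _ => h b
  rw [← dens_prod_mul_card (fun x : β × α => P (x.2, x.1)), Finset.sum_const, nsmul_eq_mul,
    Finset.card_univ, mul_comm] at hlt
  rw [one_mul] at hswap
  exact hlt.not_ge (mul_le_mul_of_nonneg_right hswap hβ₀)

/-- The strings that take the bits of `s` where `S` is set and those of `t` elsewhere. -/
def mix {m : ℕ} (S s t : Fin m → Bool) : Fin m → Bool := fun i => if S i then s i else t i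

theorem mix_mix {m : ℕ} (S s t : Fin m → Bool) : mix S (mix S s t) (mix S t s) = s := by
  funext i
  by_cases h : S i <;> simp [mix, h]

theorem mix_update {m : ℕ} (S s t : Fin m → Bool) (i : Fin m) (a b c : Bool) :
    mix (Function.update S i a) (Function.update s i b) (Function.update t i c) =
      Function.update (mix S s t) i (if a then b else c) := by
  funext j
  by_cases h : j = i
  · subst h; simp [mix]
  · simp [mix, h]

theorem update_inj_of_apply_eq {m : ℕ} {s t : Fin m → Bool} {i : Fin m} {b : Bool}
    (h : Function.update s i b = Function.update t i b) (hi : s i = t i) : s = t := by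
  funext j
  by_cases hj : j = i
  · rw [hj, hi]
  · simpa [hj] using congrFun h j

/-- The discrete derivative of `φ` in direction `i`. -/
def influence {m : ℕ} (φ : (Fin m → Bool) → ℝ) (i : Fin m) (p : Fin m → Bool) : ℝ :=
  φ (Function.update p i true) - φ (Function.update p i false)

/-- If `φ` mostly passes the cut-and-paste test, its discrete derivatives are mostly constant. -/
theorem exists_dens_influence_ne_le {m : ℕ} (φ : (Fin m → Bool) → ℝ) (i : Fin m) :
    ∃ τ, dens (fun p => influence φ i p ≠ τ) ≤
      16 * dens (fun x : (Fin m → Bool) × (Fin m → Bool) × (Fin m → Bool) =>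
        φ x.2.1 + φ x.2.2 ≠ φ (mix x.1 x.2.1 x.2.2) + φ (mix x.1 x.2.2 x.2.1)) := by
  set bad : (Fin m → Bool) × (Fin m → Bool) × (Fin m → Bool) → Prop := fun x =>
    φ x.2.1 + φ x.2.2 ≠ φ (mix x.1 x.2.1 x.2.2) + φ (mix x.1 x.2.2 x.2.1) with hbad
  have hupd : ∀ b : Bool, dens (fun x : (Fin m → Bool) × (Fin m → Bool) × (Fin m → Bool) =>
      bad (Function.update x.1 i b, Function.update x.2.1 i false,
        Function.update x.2.2 i true)) ≤ 8 * dens bad := by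
    intro b
    refine dens_comp_le bad _ (fun x => (x.1 i, x.2.1 i, x.2.2 i)) ?_ (by norm_num) ?_
    · rintro ⟨S, s, t⟩ ⟨S', s', t'⟩ h
      simp only [Prod.mk.injEq] at h
      obtain ⟨⟨h₁, h₂, h₃⟩, k₁, k₂, k₃⟩ := h
      rw [update_inj_of_apply_eq h₁ k₁, update_inj_of_apply_eq h₂ k₂,
        update_inj_of_apply_eq h₃ k₃]
    · simp only [Fintype.card_prod, Fintype.card_bool]
      norm_num
  have hmix : dens (fun x : (Fin m → Bool) × (Fin m → Bool) × (Fin m → Bool) =>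
      influence φ i (mix x.1 x.2.1 x.2.2) ≠ influence φ i (mix x.1 x.2.2 x.2.1)) ≤
      16 * dens bad := by
    have hsub := (dens_mono (P := fun x : (Fin m → Bool) × (Fin m → Bool) × (Fin m → Bool) =>
      influence φ i (mix x.1 x.2.1 x.2.2) ≠ influence φ i (mix x.1 x.2.2 x.2.1)) ?_).trans
      ((dens_or_le _ _).trans (add_le_add (hupd true) (hupd false)))
    · linarith
    · rintro ⟨S, s, t⟩ h
      by_contra! hn
      simp only [hbad, mix_update, not_not, ne_eq] at hn
      apply h
      simp only [influence]
      obtain ⟨h₁, h₂⟩ := hn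
      simp only [if_true, Bool.false_eq_true, if_false] at h₁ h₂
      linarith
  have hpair : dens (fun y : (Fin m → Bool) × (Fin m → Bool) × (Fin m → Bool) =>
      influence φ i y.1 ≠ influence φ i y.2.2) ≤ 1 * (16 * dens bad) := by
    have h := dens_comp_le
      (fun x : (Fin m → Bool) × (Fin m → Bool) × (Fin m → Bool) =>
        influence φ i (mix x.1 x.2.1 x.2.2) ≠ influence φ i (mix x.1 x.2.2 x.2.1))
      (fun y : (Fin m → Bool) × (Fin m → Bool) × (Fin m → Bool) =>
        (y.2.1, mix y.2.1 y.1 y.2.2, mix y.2.1 y.2.2 y.1)) (fun _ => ()) ?_ zero_le_one (by simp)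
    · simp only [mix_mix] at h
      linarith
    · rintro ⟨p, S, q⟩ ⟨p', S', q'⟩ h
      simp only [Prod.mk.injEq, and_true] at h
      obtain ⟨rfl, h₁, h₂⟩ := h
      have hp := mix_mix S p q
      have hq := mix_mix S q p
      rw [h₁, h₂, mix_mix] at hp
      rw [h₁, h₂, mix_mix] at hq
      rw [hp, hq]
  obtain ⟨b, hb⟩ := exists_dens_slice_le
    (fun y : (Fin m → Bool) × (Fin m → Bool) × (Fin m → Bool) =>
      influence φ i y.1 ≠ influence φ i y.2.2)
  exact ⟨influence φ i b.2, by linarith⟩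

theorem eq_pow_mul_of_snoc_eq_mul_cons {m : ℕ} {d y z : ℝ} {τ : Fin m → ℝ}
    (h : ∀ j : Fin (m + 1), (Fin.snoc τ y : Fin (m + 1) → ℝ) j =
      d * (Fin.cons z τ : Fin (m + 1) → ℝ) j) : y = d ^ (m + 1) * z := by
  have hpow : ∀ j : Fin (m + 1), (Fin.cons z τ : Fin (m + 1) → ℝ) j = d ^ (j : ℕ) * z := by
    intro j
    induction j using Fin.induction with
    | zero => simp
    | succ i ih =>
      have hi := h i.castSucc
      rw [Fin.snoc_castSucc, ih] at hi
      rw [Fin.cons_succ, hi, Fin.val_succ, Fin.val_castSucc]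
      ring
  have hl := h (Fin.last m)
  rw [Fin.snoc_last, hpow, Fin.val_last] at hl
  rw [hl]
  ring

theorem dens_init {m : ℕ} (P : (Fin m → Bool) → Prop) :
    dens (fun w : Fin (m + 1) → Bool => P (Fin.init w)) ≤ dens P := by
  have h := dens_comp_le P (fun w : Fin (m + 1) → Bool => Fin.init w)
    (fun w => w (Fin.last m)) ?_ zero_le_one (by simp [pow_succ, mul_comm])
  · simpa using h
  · intro w w' h
    simp only [Prod.mk.injEq] at h
    rw [← Fin.snoc_init_self w, ← Fin.snoc_init_self w', h.1, h.2]

theorem dens_tail {m : ℕ} (P : (Fin m → Bool) → Prop) :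
    dens (fun w : Fin (m + 1) → Bool => P (Fin.tail w)) ≤ dens P := by
  have h := dens_comp_le P (fun w : Fin (m + 1) → Bool => Fin.tail w)
    (fun w => w 0) ?_ zero_le_one (by simp [pow_succ, mul_comm])
  · simpa using h
  · intro w w' h
    simp only [Prod.mk.injEq] at h
    rw [← Fin.cons_self_tail w, ← Fin.cons_self_tail w', h.1, h.2]

theorem dens_update {m : ℕ} (P : (Fin m → Bool) → Prop) (i : Fin m) (b : Bool) :
    dens (fun w => P (Function.update w i b)) ≤ 2 * dens P := by
  refine dens_comp_le P (fun w => Function.update w i b) (fun w => w i) ?_ (by norm_num)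
    (by simp)
  intro w w' h
  simp only [Prod.mk.injEq] at h
  exact update_inj_of_apply_eq h.1 h.2

/-- If `φ` mostly passes the cut-and-paste test and the test relating its values at
consecutive windows, then `y` is the expected multiple of `z`. -/
theorem eq_pow_mul_of_dens_le {m : ℕ} (φ : (Fin m → Bool) → ℝ) {d y z : ℝ}
    (hcut : dens (fun x : (Fin m → Bool) × (Fin m → Bool) × (Fin m → Bool) =>
      φ x.2.1 + φ x.2.2 ≠ φ (mix x.1 x.2.1 x.2.2) + φ (mix x.1 x.2.2 x.2.1)) ≤ 1 / 100)
    (hshift : dens (fun w : Fin (m + 1) → Bool =>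
      φ (Fin.init w) + (if w (Fin.last m) then y else 0) ≠
        d * (φ (Fin.tail w) + if w 0 then z else 0)) ≤ 1 / 100) :
    y = d ^ (m + 1) * z := by
  choose τ hτ using fun i => exists_dens_influence_ne_le φ i
  refine eq_pow_mul_of_snoc_eq_mul_cons (τ := τ) fun j => ?_
  set A : (Fin (m + 1) → Bool) → ℝ := fun w =>
    φ (Fin.init w) + (if w (Fin.last m) then y else 0) with hA
  set B : (Fin (m + 1) → Bool) → ℝ := fun w => φ (Fin.tail w) + (if w 0 then z else 0) with hB
  have hA' : dens (fun w => influence A j w ≠ (Fin.snoc τ y : Fin (m + 1) → ℝ) j) ≤ 16 / 100 := by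
    induction j using Fin.lastCases with
    | last =>
      have : ∀ w, influence A (Fin.last m) w = y := fun w => by
        simp [influence, hA, Fin.init_update_last]
      simp only [this, Fin.snoc_last, ne_eq, not_true_eq_false]
      simp [dens]
      norm_num
    | cast i =>
      have : ∀ w, influence A i.castSucc w = influence φ i (Fin.init w) := fun w => by
        simp [influence, hA, Fin.init_update_castSucc, (Fin.castSucc_lt_last i).ne']
      simp only [this, Fin.snoc_castSucc]
      linarith [dens_init fun p => influence φ i p ≠ τ i, hτ i]
  have hB' : dens (fun w => influence B j w ≠ (Fin.cons z τ : Fin (m + 1) → ℝ) j) ≤ 16 / 100 := by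
    induction j using Fin.cases with
    | zero =>
      have : ∀ w, influence B 0 w = z := fun w => by
        simp [influence, hB, Fin.tail_update_zero]
      simp only [this, Fin.cons_zero, ne_eq, not_true_eq_false]
      simp [dens]
      norm_num
    | succ i =>
      have : ∀ w, influence B i.succ w = influence φ i (Fin.tail w) := fun w => by
        simp [influence, hB, Fin.tail_update_succ, (Fin.succ_ne_zero i).symm]
      simp only [this, Fin.cons_succ]
      linarith [dens_tail fun p => influence φ i p ≠ τ i, hτ i]
  have ht := dens_update (fun w => A w ≠ d * B w) j true
  have hf := dens_update (fun w => A w ≠ d * B w) j false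
  have hor := (dens_or_le _ _).trans (add_le_add
    ((dens_or_le _ _).trans (add_le_add hA' hB')) ((dens_or_le _ _).trans (add_le_add ht hf)))
  obtain ⟨w, hw⟩ := exists_not_of_dens_lt_one (lt_of_le_of_lt hor (by linarith))
  push Not at hw
  obtain ⟨⟨h₁, h₂⟩, h₃, h₄⟩ := hw
  rw [← h₁, ← h₂, influence, influence, h₃, h₄]
  ring

/-- Constraints forcing `E = x ^ 2 + x`, where `o = 1` and `A`, `b`, `B`, `D` are auxiliary. -/
def squareGadget {V : Type} (o x A b B D E : V) : List (EtrInv V) :=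
  [.inv x A, .add x o b, .inv b B, .add D B A, .inv D E]

theorem eq_of_sat_squareGadget {V : Type} {f : V → ℝ} {o x A b B D E : V} (ho : f o = 1)
    (h : ∀ ct ∈ squareGadget o x A b B D E, ct.Sat f) : f E = f x ^ 2 + f x := by
  simp only [squareGadget, List.forall_mem_cons, EtrInv.Sat, ho] at h
  obtain ⟨h₁, h₂, h₃, h₄, h₅, -⟩ := h
  have hD : f D * (f x * f b) = 1 := by
    linear_combination f x * f b * h₄ - f x * h₃ + f b * h₁ - h₂
  have hD₀ : f D ≠ 0 := left_ne_zero_of_mul_eq_one h₅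
  have hE : f E = f x * f b := mul_left_cancel₀ hD₀ (h₅.trans hD.symm)
  rw [hE, ← h₂]
  ring

theorem sat_squareGadget {V : Type} {f : V → ℝ} {o x A b B D E : V} (ho : f o = 1)
    (hx : 0 < f x) (hA : f A = 1 / f x) (hb : f b = f x + 1) (hB : f B = 1 / (f x + 1))
    (hD : f D = 1 / (f x ^ 2 + f x)) (hE : f E = f x ^ 2 + f x) :
    ∀ ct ∈ squareGadget o x A b B D E, ct.Sat f := by
  have hx₁ : f x + 1 ≠ 0 := by positivity
  have hx₂ : f x ^ 2 + f x ≠ 0 := by positivity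
  simp only [squareGadget, List.forall_mem_cons, EtrInv.Sat, ho, hA, hb, hB, hD, hE]
  refine ⟨by field_simp, trivial, by field_simp, ?_, by field_simp, by simp⟩
  have h : f x ^ 2 + f x = f x * (f x + 1) := by ring
  rw [h]
  field_simp
  ring

/-- Constraints forcing `x * y = z`, where `o = 1` and `a` lists auxiliary variables. -/
def mulGadget {V : Type} (o x y z : V) (a : Fin 23 → V) : List (EtrInv V) :=
  squareGadget o x (a 0) (a 1) (a 2) (a 3) (a 4) ++
  squareGadget o y (a 5) (a 6) (a 7) (a 8) (a 9) ++
  squareGadget o (a 18) (a 10) (a 11) (a 12) (a 13) (a 14) ++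
  [.add (a 15) (a 15) (a 4), .add (a 16) (a 16) (a 9), .add x y (a 17),
    .add (a 18) (a 18) (a 17), .add (a 15) (a 16) (a 19), .add (a 20) (a 20) (a 19),
    .add (a 18) z (a 21), .add (a 22) (a 22) (a 21), .add (a 20) (a 22) (a 14)]

theorem mul_eq_of_sat_mulGadget {V : Type} {f : V → ℝ} {o x y z : V} {a : Fin 23 → V}
    (ho : f o = 1) (h : ∀ ct ∈ mulGadget o x y z a, ct.Sat f) : f x * f y = f z := by
  simp only [mulGadget, List.forall_mem_append] at h
  obtain ⟨⟨⟨hx, hy⟩, hm⟩, h⟩ := h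
  have hx' := eq_of_sat_squareGadget ho hx
  have hy' := eq_of_sat_squareGadget ho hy
  have hm' := eq_of_sat_squareGadget ho hm
  simp only [List.forall_mem_cons, EtrInv.Sat] at h
  obtain ⟨h₁, h₂, h₃, h₄, h₅, h₆, h₇, h₈, h₉, -⟩ := h
  have hmid : f (a 18) = (f x + f y) / 2 := by linarith
  rw [hmid] at hm'
  have hz : f z = 2 * f (a 14) - (f (a 4) + f (a 9)) / 2 - f (a 18) := by linarith
  rw [hz, hm', hx', hy', hmid]
  ring

/-- The values of the auxiliary variables of `mulGadget` at `x = X`, `y = Y`. -/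
noncomputable def mulGadgetValue (X Y : ℝ) : Fin 23 → ℝ :=
  ![1 / X, X + 1, 1 / (X + 1), 1 / (X ^ 2 + X), X ^ 2 + X,
    1 / Y, Y + 1, 1 / (Y + 1), 1 / (Y ^ 2 + Y), Y ^ 2 + Y,
    1 / ((X + Y) / 2), (X + Y) / 2 + 1, 1 / ((X + Y) / 2 + 1),
    1 / (((X + Y) / 2) ^ 2 + (X + Y) / 2), ((X + Y) / 2) ^ 2 + (X + Y) / 2,
    (X ^ 2 + X) / 2, (Y ^ 2 + Y) / 2, X + Y, (X + Y) / 2,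
    (X ^ 2 + X) / 2 + (Y ^ 2 + Y) / 2, ((X ^ 2 + X) / 2 + (Y ^ 2 + Y) / 2) / 2,
    (X + Y) / 2 + X * Y, ((X + Y) / 2 + X * Y) / 2]

theorem one_div_mem_Icc {t : ℝ} (h : t ∈ Set.Icc (1 / 2 : ℝ) 2) :
    1 / t ∈ Set.Icc (1 / 2 : ℝ) 2 := by
  obtain ⟨h₁, h₂⟩ := h
  constructor
  · exact one_div_le_one_div_of_le (by linarith) h₂
  · rw [div_le_iff₀ (by linarith)]
    linarith

theorem mulGadgetValue_mem_Icc {X Y : ℝ} (hX : X ∈ Set.Icc (16 / 25 : ℝ) 1)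
    (hY : Y ∈ Set.Icc (16 / 25 : ℝ) 1) (hXY : 16 / 25 ≤ X * Y) (i : Fin 23) :
    mulGadgetValue X Y i ∈ Set.Icc (1 / 2 : ℝ) 2 := by
  have hM : (X + Y) / 2 ∈ Set.Icc (16 / 25 : ℝ) 1 := by
    constructor <;> linarith [hX.1, hX.2, hY.1, hY.2]
  have hsq : ∀ {t : ℝ}, t ∈ Set.Icc (16 / 25 : ℝ) 1 → 1 ≤ t ^ 2 + t ∧ t ^ 2 + t ≤ 2 := by
    rintro t ⟨h₁, h₂⟩
    constructor <;> nlinarith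
  have hXs := hsq hX
  have hYs := hsq hY
  have hMs := hsq hM
  have hXY' : X * Y ≤ 1 := mul_le_one₀ hX.2 (by linarith [hY.1]) hY.2
  obtain ⟨hX₁, hX₂⟩ := hX
  obtain ⟨hY₁, hY₂⟩ := hY
  obtain ⟨hM₁, hM₂⟩ := hM
  fin_cases i <;> simp only [mulGadgetValue] <;>
    first
    | (refine one_div_mem_Icc ⟨?_, ?_⟩ <;> linarith)
    | (show _ ∈ _; constructor <;> simp <;> linarith)

theorem sat_mulGadget {V : Type} {f : V → ℝ} {o x y z : V} {a : Fin 23 → V} (ho : f o = 1)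
    (hx : 0 < f x) (hy : 0 < f y) (hz : f x * f y = f z)
    (ha : ∀ i, f (a i) = mulGadgetValue (f x) (f y) i) :
    ∀ ct ∈ mulGadget o x y z a, ct.Sat f := by
  have hm : f (a 18) = (f x + f y) / 2 := by rw [ha]; rfl
  simp only [mulGadget, List.forall_mem_append]
  refine ⟨⟨⟨sat_squareGadget ho hx ?_ ?_ ?_ ?_ ?_, sat_squareGadget ho hy ?_ ?_ ?_ ?_ ?_⟩,
    sat_squareGadget ho (by rw [hm]; linarith) ?_ ?_ ?_ ?_ ?_⟩, ?_⟩
  on_goal 16 =>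
    simp only [List.forall_mem_cons, EtrInv.Sat, ha, ← hz]
    simp [mulGadgetValue]
    ring
  all_goals first | (rw [hm, ha]; rfl) | (rw [ha]; rfl)

/-- Constraints forcing `o = 1` and `c = 15 / 16`, where `a` lists auxiliary variables. -/
def constGadget {V : Type} (o c : V) (a : Fin 6 → V) : List (EtrInv V) :=
  [.one o, .add (a 0) (a 0) o, .add o (a 0) (a 1), .add (a 2) (a 2) (a 1),
    .add (a 2) o (a 3), .add (a 4) (a 4) (a 3), .add (a 4) o (a 5), .add c c (a 5)]

theorem eq_of_sat_constGadget {V : Type} {f : V → ℝ} {o c : V} {a : Fin 6 → V}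
    (h : ∀ ct ∈ constGadget o c a, ct.Sat f) : f o = 1 ∧ f c = 15 / 16 := by
  simp only [constGadget, List.forall_mem_cons, EtrInv.Sat] at h
  obtain ⟨h₁, h₂, h₃, h₄, h₅, h₆, h₇, h₈, -⟩ := h
  exact ⟨h₁, by linarith⟩

/-- The values of the auxiliary variables of `constGadget`. -/
noncomputable def constGadgetValue : Fin 6 → ℝ := ![1 / 2, 3 / 2, 3 / 4, 7 / 4, 7 / 8, 15 / 8]

theorem sat_constGadget {V : Type} {f : V → ℝ} {o c : V} {a : Fin 6 → V} (ho : f o = 1)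
    (hc : f c = 15 / 16) (ha : ∀ i, f (a i) = constGadgetValue i) :
    ∀ ct ∈ constGadget o c a, ct.Sat f := by
  simp only [constGadget, List.forall_mem_cons, EtrInv.Sat, ho, hc, ha]
  simp [constGadgetValue]
  norm_num

theorem constGadgetValue_mem_Icc (i : Fin 6) :
    constGadgetValue i ∈ Set.Icc (1 / 2 : ℝ) 2 := by
  fin_cases i <;> simp [constGadgetValue] <;> norm_num

/-- If `f` satisfies most constraints of a union of bundles of equal size, then it satisfies
most bundles entirely. -/
theorem dens_exists_not_sat_le {V Ω : Type} [Fintype Ω] [Nonempty Ω] (B : Ω → List (EtrInv V))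
    {K : ℕ} (hK : ∀ ω, (B ω).length = K) (f : V → ℝ) (c : ℝ)
    (h : c * ((Finset.univ.val.bind fun ω => (B ω : Multiset (EtrInv V))).card : ℝ) ≤
      (((Finset.univ.val.bind fun ω => (B ω : Multiset (EtrInv V))).filter
        fun ct => ct.Sat f).card : ℝ)) :
    dens (fun ω => ∃ ct ∈ B ω, ¬ ct.Sat f) ≤ (1 - c) * K := by
  have hcard : ∀ ω, (((B ω : Multiset (EtrInv V)).filter fun ct => ct.Sat f).card : ℝ) ≤
      K - if ∃ ct ∈ B ω, ¬ ct.Sat f then 1 else 0 := by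
    intro ω
    split_ifs with hω
    · have hlt : ((B ω : Multiset (EtrInv V)).filter fun ct => ct.Sat f).card < K := by
        rw [← hK ω, ← Multiset.coe_card]
        refine Multiset.card_lt_card (lt_of_le_of_ne (Multiset.filter_le _ _) fun heq => ?_)
        obtain ⟨ct, hct, hn⟩ := hω
        exact hn (Multiset.filter_eq_self.1 heq ct hct)
      rw [le_sub_iff_add_le]
      exact_mod_cast hlt
    · rw [sub_zero, ← hK ω, ← Multiset.coe_card]
      exact Nat.cast_le.2 (Multiset.card_le_card (Multiset.filter_le _ _))
  have hΩ : (0 : ℝ) < Fintype.card Ω := by exact_mod_cast Fintype.card_pos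
  rw [Multiset.filter_bind, Multiset.card_bind, Multiset.card_bind] at h
  have hsum : c * (Fintype.card Ω * K) ≤
      ∑ ω, (((B ω : Multiset (EtrInv V)).filter fun ct => ct.Sat f).card : ℝ) := by
    refine le_trans (le_of_eq ?_) (h.trans (le_of_eq ?_))
    · simp [hK]
    · rw [← Nat.cast_sum]
      rfl
  have hle := hsum.trans (Finset.sum_le_sum fun ω _ => hcard ω)
  rw [Finset.sum_sub_distrib, Finset.sum_const, Finset.card_univ, nsmul_eq_mul] at hle
  rw [dens, div_le_iff₀ hΩ, Finset.card_filter]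
  push_cast
  nlinarith

/-- A satisfiable system of bundles of multiplicative constraints becomes an ETR-INV instance. -/
theorem exists_etrInv_of_mul {M Ω : Type} [Fintype M] [Fintype Ω] [Nonempty Ω] {J : ℕ}
    (T : Ω → Fin J → M × M × M) (o c : M) (g : M → ℝ)
    (hg : ∀ v, g v ∈ Set.Icc (16 / 25 : ℝ) 1) (ho : g o = 1) (hc : g c = 15 / 16)
    (hT : ∀ ω j, g (T ω j).1 * g (T ω j).2.1 = g (T ω j).2.2) :
    ∃ (n : ℕ) (φ : Multiset (EtrInv (Fin n))),
      n = Fintype.card M + (Fintype.card Ω * (J * 23) + 6) ∧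
      (∃ f : Fin n → ℝ, InRange f ∧ ∀ ct ∈ φ, EtrInv.Sat f ct) ∧
      ∀ (f : Fin n → ℝ) (r : ℝ), InRange f → r * (Multiset.card φ : ℝ) ≤
          ((φ.filter (fun ct => EtrInv.Sat f ct)).card : ℝ) →
        ∃ ι : M → Fin n, dens (fun ω => ¬ (f (ι o) = 1 ∧ f (ι c) = 15 / 16 ∧
          ∀ j, f (ι (T ω j).1) * f (ι (T ω j).2.1) = f (ι (T ω j).2.2))) ≤
            (1 - r) * (24 * J + 8 : ℕ) := by
  let e := Fintype.equivFin (M ⊕ ((Ω × Fin J × Fin 23) ⊕ Fin 6))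
  let ι : M → Fin (Fintype.card (M ⊕ ((Ω × Fin J × Fin 23) ⊕ Fin 6))) := fun v => e (Sum.inl v)
  let B : Ω → List (EtrInv (Fin (Fintype.card (M ⊕ ((Ω × Fin J × Fin 23) ⊕ Fin 6))))) :=
    fun ω => constGadget (ι o) (ι c) (fun i => e (Sum.inr (Sum.inr i))) ++
      (List.finRange J).flatMap fun j => mulGadget (ι o) (ι (T ω j).1) (ι (T ω j).2.1)
        (ι (T ω j).2.2) fun i => e (Sum.inr (Sum.inl (ω, j, i)))
  have hB : ∀ ω, (B ω).length = 24 * J + 8 := by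
    intro ω
    simp [B, constGadget, mulGadget, squareGadget, List.length_flatMap]
    ring
  refine ⟨_, Finset.univ.val.bind fun ω => Multiset.ofList (B ω), by simp, ?_, ?_⟩
  · let F : M ⊕ ((Ω × Fin J × Fin 23) ⊕ Fin 6) → ℝ := Sum.elim g (Sum.elim
      (fun x => mulGadgetValue (g (T x.1 x.2.1).1) (g (T x.1 x.2.1).2.1) x.2.2)
      constGadgetValue)
    refine ⟨fun v => F (e.symm v), fun v => ?_, fun ct hct => ?_⟩
    · rcases h : e.symm v with a | ⟨ω, j, i⟩ | i
      · simp only [h, F, Sum.elim_inl]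
        exact ⟨by linarith [(hg a).1], by linarith [(hg a).2]⟩
      · simp only [h, F, Sum.elim_inl, Sum.elim_inr]
        exact mulGadgetValue_mem_Icc (hg _) (hg _) (by rw [hT]; exact (hg _).1) i
      · simp only [h, F, Sum.elim_inr]
        exact constGadgetValue_mem_Icc i
    · simp only [Multiset.mem_bind, Finset.mem_val, Finset.mem_univ, true_and,
        Multiset.mem_coe, B, List.mem_append, List.mem_flatMap, List.mem_finRange] at hct
      obtain ⟨ω, hct | ⟨j, hct⟩⟩ := hct
      · exact sat_constGadget (by simp [ι, F, ho]) (by simp [ι, F, hc]) (by simp [F]) ct hct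
      · refine sat_mulGadget (by simp [ι, F, ho]) ?_ ?_ ?_ ?_ ct hct
        · simpa [ι, F] using by linarith [(hg (T ω j).1).1]
        · simpa [ι, F] using by linarith [(hg (T ω j).2.1).1]
        · simpa [ι, F] using hT ω j
        · simp [ι, F]
  · intro f r _ hr
    refine ⟨ι, (dens_mono fun ω => ?_).trans (dens_exists_not_sat_le B hB f r hr)⟩
    contrapose!
    intro hsat
    simp only [B, List.forall_mem_append, List.mem_flatMap, List.mem_finRange, true_and] at hsat
    obtain ⟨hconst, hmul⟩ := hsat
    obtain ⟨h₁, h₂⟩ := eq_of_sat_constGadget hconst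
    exact ⟨h₁, h₂, fun j => mul_eq_of_sat_mulGadget h₁ fun ct hct => hmul ct ⟨j, hct⟩⟩

/-- The inputs of the cut-and-paste test. -/
abbrev CutInput (m : ℕ) : Type := (Fin m → Bool) × (Fin m → Bool) × (Fin m → Bool)

/-- The inputs of a bundle of tests. -/
abbrev TestInput (m : ℕ) : Type :=
  CutInput m × ((Fin (m + 1) → Bool) × (CutInput m × (Fin (m + 1) → Bool)))

/-- The variables of the multiplicative system. Their logarithms should be as follows: `o` is
zero, `c` is a constant, `z` is `c` divided by a large power of two, `P` and all `Q w` are linear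
in the bits of their argument, and `D w` is `2 ^ (m + 1)` times `H w`. The others are
auxiliary. -/
inductive TestVar (m : ℕ) : Type
  | o : TestVar m
  | c : TestVar m
  | z : TestVar m
  | P : (Fin m → Bool) → TestVar m
  | D : (Fin (m + 1) → Bool) → TestVar m
  | H : (Fin (m + 1) → Bool) → TestVar m
  | Q : (Fin (m + 1) → Bool) → (Fin m → Bool) → TestVar m
  | A : CutInput m → TestVar m
  | B : (Fin (m + 1) → Bool) → CutInput m → TestVar m
  | L : (Fin (m + 1) → Bool) → (Fin (m + 1) → Bool) → TestVar m
  | R : (Fin (m + 1) → Bool) → (Fin (m + 1) → Bool) → TestVar m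

namespace TestVar

/-- An encoding of the variables that bounds their number. -/
def code {m : ℕ} : TestVar m → Fin 11 × TestInput m
  | o => (0, default)
  | c => (1, default)
  | z => (2, default)
  | P s => (3, ((s, default), default))
  | D w => (4, (default, (w, default)))
  | H w => (5, (default, (w, default)))
  | Q w s => (6, ((s, default), (w, default)))
  | A x => (7, (x, default))
  | B w x => (8, (x, (w, default)))
  | L w v => (9, (default, (w, (default, v))))
  | R w v => (10, (default, (w, (default, v))))

theorem code_injective {m : ℕ} : Function.Injective (code (m := m)) := by
  intro a b h
  cases a <;> cases b <;> simp_all [code]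

noncomputable instance {m : ℕ} : Fintype (TestVar m) := Fintype.ofInjective code code_injective

theorem card_le (m : ℕ) : Fintype.card (TestVar m) ≤ 11 * Fintype.card (TestInput m) := by
  simpa using Fintype.card_le_of_injective code (code_injective (m := m))

/-- The variable `y` if the bit `b` is set, and the neutral variable otherwise. -/
def bit {m : ℕ} (b : Bool) (y : TestVar m) : TestVar m := if b then y else o

/-- The bundle of multiplicative constraints tested on a given input. -/
def tests {m : ℕ} (ω : TestInput m) : Fin 9 → TestVar m × TestVar m × TestVar m :=
  let x := ω.1
  let w := ω.2.1
  let y := ω.2.2.1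
  let v := ω.2.2.2
  ![(P x.2.1, P x.2.2, A x),
    (P (mix x.1 x.2.1 x.2.2), P (mix x.1 x.2.2 x.2.1), A x),
    (P (Fin.init w), bit (w (Fin.last m)) c, D w),
    (P (Fin.tail w), bit (w 0) z, H w),
    (Q w y.2.1, Q w y.2.2, B w y),
    (Q w (mix y.1 y.2.1 y.2.2), Q w (mix y.1 y.2.2 y.2.1), B w y),
    (Q w (Fin.init v), bit (v (Fin.last m)) (D w), L w v),
    (Q w (Fin.tail v), bit (v 0) (H w), R w v),
    (R w v, R w v, L w v)]

/-- Passing most of the tests forces `c` to be the expected multiple of `z`. -/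
theorem eq_pow_mul_of_dens_tests_le {m : ℕ} (q : TestVar m → ℝ)
    (h : dens (fun ω => ¬ (q o = 0 ∧
      ∀ j, q (tests ω j).1 + q (tests ω j).2.1 = q (tests ω j).2.2)) ≤ 1 / 10000) :
    q c = 2 ^ ((m + 1) * (m + 1)) * q z := by
  have ho : q o = 0 := by
    obtain ⟨ω, hω⟩ := exists_not_of_dens_lt_one (h.trans_lt (by norm_num))
    exact (not_not.1 hω).1
  have hbit : ∀ b y, q (bit b y) = if b then q y else 0 := by
    intro b y
    cases b <;> simp [bit, ho]
  set bad : (Fin (m + 1) → Bool) × (CutInput m × (Fin (m + 1) → Bool)) → Prop := fun x =>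
    ¬ ∀ ω₁, ∀ j : Fin 9, 2 ≤ j → q (tests (ω₁, x) j).1 + q (tests (ω₁, x) j).2.1 =
      q (tests (ω₁, x) j).2.2 with hbad
  have hbad' : dens bad ≤ 1 / 10000 := by
    rw [← dens_snd (α := CutInput m)]
    refine (dens_mono fun ω => ?_).trans h
    intro hb hω
    refine hb fun ω₁ j hj => ?_
    have := hω.2 j
    fin_cases j <;> first | exact absurd hj (by decide) | exact this
  have hgood : ∀ x, ¬ bad x →
      q (P (Fin.init x.1)) + (if x.1 (Fin.last m) then q c else 0) = q (D x.1) ∧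
      q (P (Fin.tail x.1)) + (if x.1 0 then q z else 0) = q (H x.1) ∧
      q (Q x.1 x.2.1.2.1) + q (Q x.1 x.2.1.2.2) =
        q (Q x.1 (mix x.2.1.1 x.2.1.2.1 x.2.1.2.2)) +
          q (Q x.1 (mix x.2.1.1 x.2.1.2.2 x.2.1.2.1)) ∧
      q (Q x.1 (Fin.init x.2.2)) + (if x.2.2 (Fin.last m) then q (D x.1) else 0) =
        2 * (q (Q x.1 (Fin.tail x.2.2)) + if x.2.2 0 then q (H x.1) else 0) := by
    intro x hx
    have hx := not_not.1 hx default
    have h₂ := hx 2 (by decide)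
    have h₃ := hx 3 (by decide)
    have h₄ := hx 4 (by decide)
    have h₅ := hx 5 (by decide)
    have h₆ := hx 6 (by decide)
    have h₇ := hx 7 (by decide)
    have h₈ := hx 8 (by decide)
    simp only [tests, Matrix.cons_val, hbit] at h₂ h₃ h₄ h₅ h₆ h₇ h₈
    exact ⟨h₂, h₃, h₄.trans h₅.symm, by linarith⟩
  rw [pow_mul]
  refine eq_pow_mul_of_dens_le (fun s => q (P s)) ?_ ?_
  · rw [← dens_fst (β := (Fin (m + 1) → Bool) × (CutInput m × (Fin (m + 1) → Bool)))]
    refine ((dens_mono fun ω => ?_).trans h).trans (by norm_num)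
    exact fun hne hω => hne ((hω.2 0).trans (hω.2 1).symm)
  · have hmarkov := dens_slice_gt_mul_le bad (1 / 100)
    refine (dens_mono fun w => ?_).trans
      (show dens (fun w => 1 / 100 < dens fun y => bad (w, y)) ≤ 1 / 100 by linarith)
    intro hne
    by_contra hw
    have hw := not_lt.1 hw
    obtain ⟨y, hy⟩ := exists_not_of_dens_lt_one (hw.trans_lt (by norm_num))
    obtain ⟨hD, hH, -⟩ := hgood (w, y) hy
    refine hne (hD.trans (Eq.trans ?_ (congrArg (2 ^ (m + 1) * ·) hH.symm)))
    refine eq_pow_mul_of_dens_le (fun s => q (Q w s)) ?_ ?_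
    · rw [← dens_fst (β := Fin (m + 1) → Bool)]
      refine (dens_mono fun y => ?_).trans hw
      exact fun hne => by_contra fun hy => hne (hgood (w, y) hy).2.2.1
    · rw [← dens_snd (α := CutInput m)]
      refine (dens_mono fun y => ?_).trans hw
      exact fun hne => by_contra fun hy => hne (hgood (w, y) hy).2.2.2

end TestVar

/-- The number with binary digits `w`, read in base `d`. -/
noncomputable def digitSum (d : ℝ) {m : ℕ} (w : Fin m → Bool) : ℝ :=
  ∑ i, if w i then d ^ (i : ℕ) else 0

theorem digitSum_nonneg {d : ℝ} (hd : 0 ≤ d) {m : ℕ} (w : Fin m → Bool) : 0 ≤ digitSum d w :=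
  Finset.sum_nonneg fun i _ => by split_ifs <;> positivity

theorem digitSum_init (d : ℝ) {m : ℕ} (w : Fin (m + 1) → Bool) :
    digitSum d w = digitSum d (Fin.init w) + if w (Fin.last m) then d ^ m else 0 := by
  simp only [digitSum, Fin.sum_univ_castSucc]
  rfl

theorem digitSum_tail (d : ℝ) {m : ℕ} (w : Fin (m + 1) → Bool) :
    digitSum d w = d * digitSum d (Fin.tail w) + if w 0 then 1 else 0 := by
  simp only [digitSum, Fin.sum_univ_succ, Fin.val_zero, pow_zero, Finset.mul_sum]
  rw [add_comm]
  congr 1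
  refine Finset.sum_congr rfl fun i _ => ?_
  by_cases h : w i.succ = true <;> simp [h, Fin.tail, pow_succ']

theorem digitSum_mix (d : ℝ) {m : ℕ} (S s t : Fin m → Bool) :
    digitSum d s + digitSum d t = digitSum d (mix S s t) + digitSum d (mix S t s) := by
  simp only [digitSum, ← Finset.sum_add_distrib]
  refine Finset.sum_congr rfl fun i _ => ?_
  by_cases h : S i <;> simp [mix, h, add_comm]

theorem digitSum_le_pow {d : ℝ} (hd : 2 ≤ d) : ∀ {m : ℕ} (w : Fin m → Bool),
    digitSum d w ≤ d ^ m
  | 0, w => by simp [digitSum]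
  | m + 1, w => by
    have ih := digitSum_le_pow hd (Fin.init w)
    have hpow : 0 < d ^ m := by positivity
    rw [digitSum_init, pow_succ]
    split_ifs <;> nlinarith

theorem digitSum_le_two_mul_pow {d : ℝ} (hd : 2 ≤ d) {m : ℕ} (w : Fin (m + 1) → Bool) :
    digitSum d w ≤ 2 * d ^ m := by
  have h := digitSum_le_pow hd (Fin.init w)
  have hpow : 0 < d ^ m := by positivity
  rw [digitSum_init]
  split_ifs <;> linarith

namespace TestVar

/-- The exponents of the intended solution. -/
noncomputable def exponent {m : ℕ} : TestVar m → ℝ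
  | o => 0
  | c => 1
  | z => ((2 ^ (m + 1)) ^ (m + 1))⁻¹
  | P s => ((2 ^ (m + 1)) ^ (m + 1))⁻¹ * (2 ^ (m + 1) * digitSum (2 ^ (m + 1)) s)
  | D w => ((2 ^ (m + 1)) ^ (m + 1))⁻¹ * (2 ^ (m + 1) * digitSum (2 ^ (m + 1)) w)
  | H w => ((2 ^ (m + 1)) ^ (m + 1))⁻¹ * digitSum (2 ^ (m + 1)) w
  | Q w s => ((2 ^ (m + 1)) ^ (m + 1))⁻¹ * digitSum (2 ^ (m + 1)) w * (2 * digitSum 2 s)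
  | A x => ((2 ^ (m + 1)) ^ (m + 1))⁻¹ * (2 ^ (m + 1) * digitSum (2 ^ (m + 1)) x.2.1) +
      ((2 ^ (m + 1)) ^ (m + 1))⁻¹ * (2 ^ (m + 1) * digitSum (2 ^ (m + 1)) x.2.2)
  | B w x => ((2 ^ (m + 1)) ^ (m + 1))⁻¹ * digitSum (2 ^ (m + 1)) w * (2 * digitSum 2 x.2.1) +
      ((2 ^ (m + 1)) ^ (m + 1))⁻¹ * digitSum (2 ^ (m + 1)) w * (2 * digitSum 2 x.2.2)
  | L w v => ((2 ^ (m + 1)) ^ (m + 1))⁻¹ * digitSum (2 ^ (m + 1)) w * (2 * digitSum 2 v)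
  | R w v => ((2 ^ (m + 1)) ^ (m + 1))⁻¹ * digitSum (2 ^ (m + 1)) w * digitSum 2 v

theorem exponent_bit {m : ℕ} (b : Bool) (y : TestVar m) :
    exponent (bit b y) = if b then exponent y else 0 := by
  cases b <;> simp [bit, exponent]

theorem exponent_tests {m : ℕ} (ω : TestInput m) (j : Fin 9) :
    exponent (tests ω j).1 + exponent (tests ω j).2.1 = exponent (tests ω j).2.2 := by
  obtain ⟨⟨S, s, t⟩, w, ⟨S', s', t'⟩, v⟩ := ω
  have hd : ((2 : ℝ) ^ (m + 1)) ^ (m + 1) ≠ 0 := by positivity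
  fin_cases j
  · rfl
  · change _ * (_ * digitSum _ (mix S s t)) + _ * (_ * digitSum _ (mix S t s)) =
      _ * (_ * digitSum _ s) + _ * (_ * digitSum _ t)
    linear_combination -((2 ^ (m + 1)) ^ (m + 1))⁻¹ * 2 ^ (m + 1) *
      digitSum_mix (2 ^ (m + 1)) S s t
  · change exponent (P (Fin.init w)) + exponent (bit (w (Fin.last m)) c) = exponent (D w)
    rw [exponent_bit]
    simp only [exponent, digitSum_init _ w]
    split_ifs
    · field_simp
      ring
    · ring
  · change exponent (P (Fin.tail w)) + exponent (bit (w 0) z) = exponent (H w)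
    rw [exponent_bit]
    simp only [exponent, digitSum_tail _ w]
    split_ifs <;> ring
  · rfl
  · change _ * (_ * digitSum _ (mix S' s' t')) + _ * (_ * digitSum _ (mix S' t' s')) =
      _ * (_ * digitSum _ s') + _ * (_ * digitSum _ t')
    linear_combination -((2 ^ (m + 1)) ^ (m + 1))⁻¹ * digitSum (2 ^ (m + 1)) w * 2 *
      digitSum_mix 2 S' s' t'
  · change exponent (Q w (Fin.init v)) + exponent (bit (v (Fin.last m)) (D w)) =
      exponent (L w v)
    rw [exponent_bit]
    simp only [exponent, digitSum_init _ v]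
    split_ifs <;> ring
  · change exponent (Q w (Fin.tail v)) + exponent (bit (v 0) (H w)) = exponent (R w v)
    rw [exponent_bit]
    simp only [exponent, digitSum_tail _ v]
    split_ifs <;> ring
  · change exponent (R w v) + exponent (R w v) = exponent (L w v)
    simp only [exponent]
    ring

theorem exponent_mem_Icc {m : ℕ} (v : TestVar m) : exponent v ∈ Set.Icc (0 : ℝ) 4 := by
  set d : ℝ := 2 ^ (m + 1) with hd
  have hd₂ : 2 ≤ d := by
    rw [hd, pow_succ]
    linarith [one_le_pow₀ (one_le_two (α := ℝ)) (n := m)]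
  set u : ℝ := (d ^ (m + 1))⁻¹ with hu
  have hu₀ : 0 ≤ u := by positivity
  have hud : u * (d * d ^ m) = 1 := by
    rw [hu, ← pow_succ']
    exact inv_mul_cancel₀ (by positivity)
  have hP : ∀ s : Fin m → Bool, u * (d * digitSum d s) ∈ Set.Icc (0 : ℝ) 1 := fun s => by
    have := digitSum_nonneg (by linarith : (0 : ℝ) ≤ d) s
    refine ⟨by positivity, hud ▸ ?_⟩
    gcongr
    exact digitSum_le_pow hd₂ s
  have hD : ∀ w : Fin (m + 1) → Bool, u * (d * digitSum d w) ∈ Set.Icc (0 : ℝ) 2 := fun w => by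
    have := digitSum_nonneg (by linarith : (0 : ℝ) ≤ d) w
    refine ⟨by positivity, ?_⟩
    calc u * (d * digitSum d w) ≤ u * (d * (2 * d ^ m)) := by
          gcongr
          exact digitSum_le_two_mul_pow hd₂ w
      _ = 2 := by linear_combination 2 * hud
  have hH : ∀ w : Fin (m + 1) → Bool, 0 ≤ u * digitSum d w := fun w =>
    mul_nonneg hu₀ (digitSum_nonneg (by linarith) w)
  have hHd : ∀ w : Fin (m + 1) → Bool, u * digitSum d w * (2 * 2 ^ m) ≤ 2 := fun w => by
    have h := (hD w).2
    rw [← pow_succ', ← hd]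
    linarith
  have hQ : ∀ (w : Fin (m + 1) → Bool) (s : Fin m → Bool),
      u * digitSum d w * (2 * digitSum 2 s) ∈ Set.Icc (0 : ℝ) 2 := fun w s => by
    have := hH w
    have := digitSum_nonneg (zero_le_two (α := ℝ)) s
    refine ⟨by positivity, le_trans ?_ (hHd w)⟩
    gcongr
    exact digitSum_le_pow le_rfl s
  have hR : ∀ w v : Fin (m + 1) → Bool,
      u * digitSum d w * digitSum 2 v ∈ Set.Icc (0 : ℝ) 2 := fun w v => by
    have := hH w
    have := digitSum_nonneg (zero_le_two (α := ℝ)) v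
    refine ⟨by positivity, le_trans ?_ (hHd w)⟩
    gcongr
    exact digitSum_le_two_mul_pow le_rfl v
  have hz : u ≤ 1 := inv_le_one_of_one_le₀ (one_le_pow₀ (by linarith))
  cases v with
  | o => simp [exponent]
  | c => norm_num [exponent]
  | z => exact ⟨hu₀, by simp only [exponent]; linarith⟩
  | P s => exact ⟨(hP s).1, by simp only [exponent]; linarith [(hP s).2]⟩
  | D w => exact ⟨(hD w).1, by simp only [exponent]; linarith [(hD w).2]⟩
  | H w =>
    refine ⟨hH w, ?_⟩
    simp only [exponent]
    have := hHd w
    have := one_le_pow₀ (one_le_two (α := ℝ)) (n := m)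
    nlinarith [hH w]
  | Q w s => exact ⟨(hQ w s).1, by simp only [exponent]; linarith [(hQ w s).2]⟩
  | A x =>
    exact ⟨add_nonneg (hP _).1 (hP _).1, by
      simp only [exponent]; linarith [(hP x.2.1).2, (hP x.2.2).2]⟩
  | B w x =>
    exact ⟨add_nonneg (hQ _ _).1 (hQ _ _).1, by
      simp only [exponent]; linarith [(hQ w x.2.1).2, (hQ w x.2.2).2]⟩
  | L w v =>
    have := hR w v
    simp only [exponent]
    constructor <;> linarith [this.1, this.2]
  | R w v => exact ⟨(hR w v).1, by simp only [exponent]; linarith [(hR w v).2]⟩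

end TestVar

section EisensteinBound

open Polynomial

/-- By Eisenstein's criterion, `16 * X ^ N - 15` is irreducible. -/
theorem irreducible_sixteen_mul_X_pow_sub {N : ℕ} (hN : 0 < N) :
    Irreducible (C 16 * X ^ N - C 15 : ℚ[X]) := by
  have hdeg : (C 16 * X ^ N - C 15 : ℤ[X]).natDegree = N := by
    rw [natDegree_sub_C, natDegree_C_mul_X_pow N 16 (by norm_num)]
  have hprim : (C 16 * X ^ N - C 15 : ℤ[X]).IsPrimitive := by
    intro r hr
    rw [C_dvd_iff_dvd_coeff] at hr
    have h₀ := hr 0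
    have h₁ := hr N
    simp only [coeff_sub, coeff_C_mul, coeff_X_pow, coeff_C, hN.ne', hN.ne, if_true, if_false]
      at h₀ h₁
    exact isUnit_of_dvd_one (by simpa using dvd_add h₁ h₀)
  have hirr : Irreducible (C 16 * X ^ N - C 15 : ℤ[X]) := by
    refine irreducible_of_eisenstein_criterion (P := Ideal.span {(3 : ℤ)}) ?_ ?_ ?_ ?_ ?_ hprim
    · exact (Ideal.span_singleton_prime (by norm_num)).2 Int.prime_three
    · rw [leadingCoeff, hdeg, Ideal.mem_span_singleton]
      simp only [coeff_sub, coeff_C_mul, coeff_X_pow, coeff_C, hN.ne', if_true, if_false]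
      norm_num
    · intro n hn
      have hn : n < N := by
        rw [← hdeg]
        exact coe_lt_degree.1 hn
      rw [Ideal.mem_span_singleton]
      simp only [coeff_sub, coeff_C_mul, coeff_X_pow, coeff_C, hn.ne, if_false]
      split_ifs <;> norm_num
    · rw [← natDegree_pos_iff_degree_pos, hdeg]
      exact hN
    · rw [Ideal.span_singleton_pow, Ideal.mem_span_singleton]
      simp [coeff_X_pow, hN.ne]
  simpa only [Polynomial.map_sub, Polynomial.map_mul, Polynomial.map_pow, map_X, map_C,
    Int.coe_castRingHom, Int.cast_ofNat] using
    (IsPrimitive.Int.irreducible_iff_irreducible_map_cast hprim).1 hirr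

theorem aeval_ne_zero_of_pow_eq {x : ℝ} {N : ℕ} (hx : x ^ N = 15 / 16) {p : ℚ[X]}
    (hp : p ≠ 0) (hdeg : p.natDegree < N) : aeval x p ≠ 0 := by
  intro h
  have hirr := irreducible_sixteen_mul_X_pow_sub (Nat.zero_lt_of_lt hdeg)
  have hroot : aeval x (C 16 * X ^ N - C 15 : ℚ[X]) = 0 := by
    simp only [map_sub, map_mul, map_pow, aeval_X, hx, aeval_C, eq_ratCast]
    norm_num
  have hdvd := minpoly.dvd ℚ x hroot
  have hint : IsIntegral ℚ x := (isAlgebraic_iff_isIntegral).1 ⟨p, hp, h⟩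
  have hassoc := (minpoly.irreducible hint).associated_of_dvd hirr hdvd
  have hle := natDegree_le_of_dvd ((hassoc.dvd_iff_dvd_left).1 (minpoly.dvd ℚ x h)) hp
  rw [natDegree_sub_C, natDegree_C_mul_X_pow N 16 (by norm_num)] at hle
  omega

end EisensteinBound

/-- The instance size is dominated by the degree of the extension it forces. -/
theorem size_pow_lt {k a : ℕ} (ha : a ≤ 11 * 2 ^ (8 * (10 * k) + 2)) :
    (a + (2 ^ (8 * (10 * k) + 2) * (9 * 23) + 6)) ^ k < 2 ^ ((10 * k + 1) * (10 * k + 1)) := by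
  have h : a + (2 ^ (8 * (10 * k) + 2) * (9 * 23) + 6) ≤ 2 ^ (8 * (10 * k) + 10) := by
    have h₁ : 2 ^ (8 * (10 * k) + 10) = 2 ^ (8 * (10 * k) + 2) * 256 := by
      rw [show 8 * (10 * k) + 10 = 8 * (10 * k) + 2 + 8 by ring, pow_add _ _ 8]
      norm_num
    have h₂ : 1 ≤ 2 ^ (8 * (10 * k) + 2) := Nat.one_le_two_pow
    omega
  calc _ ≤ (2 ^ (8 * (10 * k) + 10)) ^ k := Nat.pow_le_pow_left h k
    _ = 2 ^ ((8 * (10 * k) + 10) * k) := by rw [← pow_mul]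
    _ < _ := Nat.pow_lt_pow_right (by norm_num) (by nlinarith)

/-- there is a constant `0 < c < 1` such that for every `k` there is a
satisfiable ETR-INV instance with `n ≥ 2` variables such that any assignment satisfying
at least a `c` fraction of the constraints has some variable whose value is not algebraic
of degree at most `n ^ k` over `ℚ`. -/
theorem etr_inv_solution_complexity :
    ∃ c : ℝ, 0 < c ∧ c < 1 ∧ ∀ k : ℕ,
      ∃ (n : ℕ) (φ : Multiset (EtrInv (Fin n))),
        2 ≤ n ∧
        (∃ f : Fin n → ℝ, InRange f ∧ ∀ ct ∈ φ, EtrInv.Sat f ct) ∧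
        ∀ f : Fin n → ℝ, InRange f →
          c * (Multiset.card φ : ℝ) ≤
            ((φ.filter (fun ct => EtrInv.Sat f ct)).card : ℝ) →
          ∃ v : Fin n, ¬ ∃ p : Polynomial ℚ, p ≠ 0 ∧ p.natDegree ≤ n ^ k ∧
            Polynomial.aeval (f v) p = 0 := by
  refine ⟨1 - 1 / 10 ^ 7, by norm_num, by norm_num, fun k => ?_⟩
  have hcard : Fintype.card (TestInput (10 * k)) = 2 ^ (8 * (10 * k) + 2) := by
    simp only [TestInput, CutInput, Fintype.card_prod, Fintype.card_fun, Fintype.card_bool,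
      Fintype.card_fin, ← pow_add]
    congr 1
    ring
  have hbase : (0 : ℝ) < 15 / 16 := by norm_num
  obtain ⟨n, φ, hn, hsat, hsound⟩ := exists_etrInv_of_mul (TestVar.tests (m := 10 * k))
    TestVar.o TestVar.c (fun v => (15 / 16 : ℝ) ^ v.exponent)
    (fun v => by
      obtain ⟨h₀, h₄⟩ := v.exponent_mem_Icc
      refine ⟨?_, Real.rpow_le_one hbase.le (by norm_num) h₀⟩
      calc (16 / 25 : ℝ) ≤ (15 / 16 : ℝ) ^ (4 : ℝ) := by norm_num
        _ ≤ _ := Real.rpow_le_rpow_of_exponent_ge hbase (by norm_num) h₄)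
    (by simp [TestVar.exponent]) (by simp [TestVar.exponent])
    (fun ω j => by
      rw [← Real.rpow_add hbase, TestVar.exponent_tests])
  refine ⟨n, φ, by omega, hsat, fun f hf hfrac => ?_⟩
  obtain ⟨ι, hι⟩ := hsound f _ hf hfrac
  have hpos : ∀ v, 0 < f v := fun v => lt_of_lt_of_le (by norm_num) (hf v).1
  obtain ⟨ω, hω⟩ := exists_not_of_dens_lt_one (hι.trans_lt (by norm_num))
  have hc := (not_not.1 hω).2.1
  have hlog : Real.log (f (ι TestVar.c)) =
      2 ^ ((10 * k + 1) * (10 * k + 1)) * Real.log (f (ι TestVar.z)) := by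
    refine TestVar.eq_pow_mul_of_dens_tests_le (fun v => Real.log (f (ι v))) ?_
    refine ((dens_mono fun ω => mt fun h => ⟨?_, fun j => ?_⟩).trans hι).trans (by norm_num)
    · simp [h.1]
    · rw [← Real.log_mul (hpos _).ne' (hpos _).ne', h.2.2 j]
  refine ⟨ι TestVar.z, fun ⟨p, hp, hdeg, hroot⟩ => ?_⟩
  have hz : f (ι TestVar.z) ^ 2 ^ ((10 * k + 1) * (10 * k + 1)) = 15 / 16 := by
    rw [← hc]
    refine Real.log_injOn_pos (pow_pos (hpos _) _) (hpos _) ?_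
    rw [hlog, Real.log_pow]
    push_cast
    rfl
  refine aeval_ne_zero_of_pow_eq hz hp (hdeg.trans_lt ?_) hroot
  rw [hn, hcard]
  exact size_pow_lt (hcard ▸ TestVar.card_le (10 * k))
end

section
/- Let k ≥ 1 be an integer and let V be a d-dimensional linear subspace of ℝ^n that is the kernel of a matrix B with integer entries in which every row c satisfies ‖c‖₁ ≤ k. Then there exists a basis b₁, …, b_d of V in which every entry of every bᵢ is an integer of absolute value at most k^{n−1}, together with a positive integer D and a function ρ : {1, …, d} → {1, …, n}, such that every α ∈ V satisfies α = (1/D)·Σᵢ₌₁^d α_{ρ(i)}·bᵢ. -/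
open scoped Matrix

/-- The determinant is bounded by the product of the `ℓ¹`-norms of the rows. -/
theorem Matrix.abs_det_le_prod_sum_abs {ι : Type*} [Fintype ι] [DecidableEq ι]
    (A : Matrix ι ι ℤ) : |A.det| ≤ ∏ i, ∑ j, |A i j| := by
  rw [← Matrix.det_transpose, Matrix.det_apply, Finset.prod_univ_sum, Fintype.piFinset_univ]
  calc _ ≤ ∑ σ : Equiv.Perm ι, |Equiv.Perm.sign σ • ∏ i, A.transpose (σ i) i| :=
        Finset.abs_sum_le_sum_abs _ _
    _ = ∑ σ : Equiv.Perm ι, ∏ i, |A i (σ i)| := by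
        refine Finset.sum_congr rfl fun σ _ => ?_
        rcases Int.units_eq_one_or (Equiv.Perm.sign σ) with h | h <;>
          simp [h, Finset.abs_prod]
    _ = ∑ p ∈ Finset.univ.image (fun σ : Equiv.Perm ι => (σ : ι → ι)), ∏ i, |A i (p i)| := by
        rw [Finset.sum_image fun σ _ τ _ h => DFunLike.coe_injective h]
    _ ≤ _ := Finset.sum_le_sum_of_subset_of_nonneg (Finset.subset_univ _)
        fun _ _ _ => Finset.prod_nonneg fun _ _ => abs_nonneg _

/-- A minor of an integer matrix whose rows have `ℓ¹`-norm at most `k`. -/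
theorem Matrix.abs_det_submatrix_le {m n : Type*} [Fintype n] {r k : ℕ} {B : Matrix m n ℤ}
    (hB : ∀ i, ∑ j, |B i j| ≤ (k : ℤ)) (f : Fin r → m) {g : Fin r → n}
    (hg : Function.Injective g) : |(B.submatrix f g).det| ≤ (k : ℤ) ^ r := by
  classical
  refine (Matrix.abs_det_le_prod_sum_abs _).trans ?_
  calc _ ≤ ∏ _i : Fin r, (k : ℤ) := by
        refine Finset.prod_le_prod (fun _ _ => Finset.sum_nonneg fun _ _ => abs_nonneg _)
          fun i _ => le_trans ?_ (hB (f i))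
        simp only [Matrix.submatrix_apply]
        rw [← Finset.sum_image (s := Finset.univ) (g := g) (f := fun j => |B (f i) j|)
          fun a _ b _ h => hg h]
        exact Finset.sum_le_sum_of_subset_of_nonneg (Finset.subset_univ _)
          fun _ _ _ => abs_nonneg _
    _ = _ := by simp

theorem Matrix.injective_of_det_submatrix_ne_zero {R m n : Type*} [CommRing R] {r : ℕ}
    {A : Matrix m n R} {f : Fin r → m} {g : Fin r → n} (h : (A.submatrix f g).det ≠ 0) :
    Function.Injective g := by
  intro a b hab
  by_contra hne
  exact h (Matrix.det_zero_of_column_eq hne fun i => by simp [hab])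

/-- There is a nonzero minor of maximal size. -/
theorem Matrix.exists_maximal_minor {R m n : Type*} [CommRing R] [Nontrivial R] [Fintype n]
    (A : Matrix m n R) :
    ∃ (r : ℕ) (f : Fin r → m) (g : Fin r → n), (A.submatrix f g).det ≠ 0 ∧
      ∀ (f' : Fin (r + 1) → m) (g' : Fin (r + 1) → n), (A.submatrix f' g').det = 0 := by
  classical
  let P : ℕ → Prop := fun r => ∃ (f : Fin r → m) (g : Fin r → n), (A.submatrix f g).det ≠ 0
  have hP : ∀ r, P r → r ≤ Fintype.card n := by
    rintro r ⟨f, g, h⟩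
    simpa using Fintype.card_le_of_injective g (Matrix.injective_of_det_submatrix_ne_zero h)
  have h0 : P 0 := ⟨Fin.elim0, Fin.elim0, by simp⟩
  obtain ⟨f, g, h⟩ : P (Nat.findGreatest P (Fintype.card n)) :=
    Nat.findGreatest_spec (Nat.zero_le _) h0
  refine ⟨_, f, g, h, fun f' g' => ?_⟩
  by_contra hne
  have h1 : P (Nat.findGreatest P (Fintype.card n) + 1) := ⟨f', g', hne⟩
  have := Nat.le_findGreatest (hP _ h1) h1
  omega

/-- If all minors bordering a nonzero minor vanish, every entry of the matrix is determined by
Cramer's rule. -/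
theorem Matrix.det_mul_eq_sum_cramer {K m n : Type*} [Field K] {r : ℕ} {A : Matrix m n K}
    {f : Fin r → m} {g : Fin r → n} (h : (A.submatrix f g).det ≠ 0)
    (hmax : ∀ (f' : Fin (r + 1) → m) (g' : Fin (r + 1) → n), (A.submatrix f' g').det = 0)
    (i : m) (j : n) :
    (A.submatrix f g).det * A i j =
      ∑ l, A i (g l) * (A.submatrix f g).cramer (fun i' => A (f i') j) l := by
  let e : Fin r ⊕ Fin 1 ≃ Fin (r + 1) := finSumFinEquiv
  let F : Fin r ⊕ Fin 1 → m := Sum.elim f fun _ => i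
  let G : Fin r ⊕ Fin 1 → n := Sum.elim g fun _ => j
  have h0 : (A.submatrix F G).det = 0 := by
    rw [← Matrix.det_submatrix_equiv_self e.symm, Matrix.submatrix_submatrix]
    exact hmax _ _
  have hblock : A.submatrix F G = Matrix.fromBlocks (A.submatrix f g)
      (A.submatrix f fun _ => j) (A.submatrix (fun _ => i) g)
      (A.submatrix (fun _ => i) fun _ => j) := by
    ext (a | a) (b | b) <;> rfl
  have hu : IsUnit (A.submatrix f g).det := h.isUnit
  let := Matrix.invertibleOfIsUnitDet _ hu
  rw [hblock, Matrix.det_fromBlocks₁₁, mul_eq_zero, or_iff_right h, Matrix.det_fin_one,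
    Matrix.sub_apply, sub_eq_zero, Matrix.invOf_eq_nonsing_inv, Matrix.mul_assoc] at h0
  have h1 : A i j = ∑ l, A i (g l) * ((A.submatrix f g)⁻¹ *ᵥ fun i' => A (f i') j) l := h0
  rw [h1, Finset.mul_sum]
  refine Finset.sum_congr rfl fun l _ => ?_
  rw [← Matrix.det_smul_inv_mulVec_eq_cramer _ _ hu, Pi.smul_apply, smul_eq_mul]
  ring

/-- A vector in the kernel supported on the columns of a nonzero minor vanishes. -/
theorem Matrix.eq_zero_of_mulVec_eq_zero_of_minor {K m n : Type*} [Field K] [Fintype n] {r : ℕ}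
    {A : Matrix m n K} {f : Fin r → m} {g : Fin r → n} (h : (A.submatrix f g).det ≠ 0)
    {w : n → K} (hw : A *ᵥ w = 0) (hs : ∀ j ∉ Set.range g, w j = 0) : w = 0 := by
  classical
  have hg := Matrix.injective_of_det_submatrix_ne_zero h
  have h0 : w ∘ g = 0 := by
    refine Matrix.eq_zero_of_mulVec_eq_zero h (funext fun i => ?_)
    have h1 : ∑ j, A (f i) j * w j = 0 := congrFun hw (f i)
    rw [← Finset.sum_subset (Finset.subset_univ (Finset.univ.image g)) (fun j _ hj => by
      rw [hs j (by simpa using hj), mul_zero]), Finset.sum_image fun a _ b _ h => hg h] at h1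
    exact h1
  funext j
  by_cases hj : j ∈ Set.range g
  · obtain ⟨l, rfl⟩ := hj
    exact congrFun h0 l
  · exact hs j hj

/-- The kernel vector attached by Cramer's rule to a column `j` outside a minor. -/
def Matrix.cramerKernelVec {R m n : Type*} [CommRing R] [DecidableEq n] {r : ℕ}
    (A : Matrix m n R) (f : Fin r → m) (g : Fin r → n) (j : n) : n → R :=
  fun x => (if x = j then (A.submatrix f g).det else 0) -
    ∑ l, if x = g l then (A.submatrix f g).cramer (fun i => A (f i) j) l else 0

theorem Matrix.cramerKernelVec_apply_of_notMem {R m n : Type*} [CommRing R] [DecidableEq n]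
    {r : ℕ} (A : Matrix m n R) (f : Fin r → m) {g : Fin r → n} (j : n) {x : n}
    (hx : x ∉ Set.range g) :
    A.cramerKernelVec f g j x = if x = j then (A.submatrix f g).det else 0 := by
  have : ∀ l, x ≠ g l := fun l h => hx ⟨l, h.symm⟩
  simp [Matrix.cramerKernelVec, this]

theorem Matrix.cramerKernelVec_apply_of_injective {R m n : Type*} [CommRing R] [DecidableEq n]
    {r : ℕ} (A : Matrix m n R) (f : Fin r → m) {g : Fin r → n} (hg : Function.Injective g)
    {j : n} (hj : j ∉ Set.range g) (l : Fin r) :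
    A.cramerKernelVec f g j (g l) = -(A.submatrix f (Function.update g l j)).det := by
  have hne : g l ≠ j := fun h => hj ⟨l, h⟩
  have hup : (A.submatrix f g).updateCol l (fun i => A (f i) j) =
      A.submatrix f (Function.update g l j) := by
    ext a b
    by_cases hb : b = l
    · subst hb
      simp
    · simp [hb]
  simp [Matrix.cramerKernelVec, hne, hg.eq_iff, Matrix.cramer_apply, hup]

theorem Matrix.mulVec_cramerKernelVec {K m n : Type*} [Field K] [Fintype n] [DecidableEq n]
    {r : ℕ} {A : Matrix m n K} {f : Fin r → m} {g : Fin r → n}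
    (h : (A.submatrix f g).det ≠ 0)
    (hmax : ∀ (f' : Fin (r + 1) → m) (g' : Fin (r + 1) → n), (A.submatrix f' g').det = 0)
    (j : n) : A *ᵥ A.cramerKernelVec f g j = 0 := by
  funext i
  change ∑ x, A i x * A.cramerKernelVec f g j x = 0
  simp only [Matrix.cramerKernelVec, mul_sub, Finset.sum_sub_distrib, Finset.mul_sum]
  rw [Finset.sum_comm]
  simp only [mul_ite, mul_zero, Finset.sum_ite_eq', Finset.mem_univ, if_true]
  rw [← Matrix.det_mul_eq_sum_cramer h hmax]
  ring

/-- Every kernel vector is recovered from its coordinates outside a nonzero minor of maximal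
size. -/
theorem Matrix.det_smul_eq_sum_cramerKernelVec {K m n : Type*} [Field K] [Fintype n]
    [DecidableEq n] {r : ℕ} {A : Matrix m n K} {f : Fin r → m} {g : Fin r → n}
    [Fintype {j // j ∉ Set.range g}]
    (h : (A.submatrix f g).det ≠ 0)
    (hmax : ∀ (f' : Fin (r + 1) → m) (g' : Fin (r + 1) → n), (A.submatrix f' g').det = 0)
    {α : n → K} (hα : A *ᵥ α = 0) :
    (A.submatrix f g).det • α =
      ∑ j : {j // j ∉ Set.range g}, α j • A.cramerKernelVec f g j := by
  rw [← sub_eq_zero]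
  refine Matrix.eq_zero_of_mulVec_eq_zero_of_minor h ?_ fun x hx => ?_
  · rw [Matrix.mulVec_sub, Matrix.mulVec_smul, hα, Matrix.mulVec_sum]
    simp [Matrix.mulVec_smul, Matrix.mulVec_cramerKernelVec h hmax]
  · rw [Pi.sub_apply, Finset.sum_apply, sub_eq_zero, Finset.sum_eq_single ⟨x, hx⟩]
    · simp [Matrix.cramerKernelVec_apply_of_notMem _ _ _ hx, mul_comm]
    · intro j _ hj
      have : x ≠ j := fun h => hj (Subtype.ext h.symm)
      simp [Matrix.cramerKernelVec_apply_of_notMem _ _ _ hx, this]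
    · simp

theorem Matrix.cramerKernelVec_map {R S m n : Type*} [CommRing R] [CommRing S] [DecidableEq n]
    {r : ℕ} (φ : R →+* S) (A : Matrix m n R) (f : Fin r → m) (g : Fin r → n) (j x : n) :
    (A.map φ).cramerKernelVec f g j x = φ (A.cramerKernelVec f g j x) := by
  simp only [Matrix.cramerKernelVec, map_sub, map_sum, apply_ite φ, map_zero, RingHom.map_det,
    Matrix.cramer_apply]
  congr! 5
  ext a b
  simp [Matrix.updateCol_apply, apply_ite φ]

/-- Cramer kernel vectors of an integer matrix have small entries. -/
theorem Matrix.abs_cramerKernelVec_le {m n : Type*} [Fintype n] [DecidableEq n] {r k : ℕ}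
    {B : Matrix m n ℤ} (hB : ∀ i, ∑ j, |B i j| ≤ (k : ℤ)) (f : Fin r → m) {g : Fin r → n}
    (hg : Function.Injective g) {j : n} (hj : j ∉ Set.range g) (x : n) :
    |B.cramerKernelVec f g j x| ≤ (k : ℤ) ^ r := by
  by_cases hx : x ∈ Set.range g
  · obtain ⟨l, rfl⟩ := hx
    rw [Matrix.cramerKernelVec_apply_of_injective _ _ hg hj, abs_neg]
    refine Matrix.abs_det_submatrix_le hB f fun a b hab => ?_
    have hne : ∀ c, g c ≠ j := fun c h => hj ⟨c, h⟩
    by_cases ha : a = l <;> by_cases hb : b = l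
    · rw [ha, hb]
    · simp [ha, hb, (hne b).symm] at hab
    · simp [ha, hb, hne a] at hab
    · simp only [Function.update_of_ne ha, Function.update_of_ne hb] at hab
      exact hg hab
  · rw [Matrix.cramerKernelVec_apply_of_notMem _ _ _ hx]
    split_ifs
    · exact Matrix.abs_det_submatrix_le hB f hg
    · simp

/-- a kernel of an integer matrix with rows of `ℓ¹`-norm at most `k` has a
basis with integer entries of absolute value at most `k^(n−1)`, and every `α ∈ V` can be
recovered as `(1/D)·Σᵢ α_{ρ(i)}·bᵢ` for some positive integer `D` and `ρ : [d] → [n]`. -/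
theorem integer_kernel_basis (n m d k : ℕ) (hk : 1 ≤ k)
    (B : Matrix (Fin m) (Fin n) ℤ)
    (hB : ∀ i, ∑ j, |B i j| ≤ (k : ℤ))
    (V : Submodule ℝ (Fin n → ℝ))
    (hV : (V : Set (Fin n → ℝ)) = {x | ∀ i, ∑ j, (B i j : ℝ) * x j = 0})
    (hdim : Module.finrank ℝ V = d) :
    ∃ (b : Fin d → (Fin n → ℝ)) (D : ℕ) (ρ : Fin d → Fin n),
      0 < D ∧
      (∀ i, b i ∈ V) ∧
      LinearIndependent ℝ b ∧
      Submodule.span ℝ (Set.range b) = V ∧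
      (∀ i j, ∃ z : ℤ, |z| ≤ (k : ℤ) ^ (n - 1) ∧ b i j = (z : ℝ)) ∧
      ∀ α ∈ V, α = ((D : ℝ))⁻¹ • ∑ i, α (ρ i) • b i := by
  classical
  let A : Matrix (Fin m) (Fin n) ℝ := B.map (Int.castRingHom ℝ)
  have hA : ∀ x, x ∈ V ↔ A *ᵥ x = 0 := fun x => by
    rw [← SetLike.mem_coe, hV]
    exact funext_iff.symm
  obtain ⟨r, f, g, hdet, hmax⟩ := A.exists_maximal_minor
  have hg := Matrix.injective_of_det_submatrix_ne_zero hdet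
  let δ : ℤ := (B.submatrix f g).det
  have hδ : (A.submatrix f g).det = (δ : ℝ) := ((Int.castRingHom ℝ).map_det _).symm
  have hδ0 : (δ : ℝ) ≠ 0 := hδ ▸ hdet
  have hδz : δ ≠ 0 := by exact_mod_cast hδ0
  have hs : (δ.sign : ℝ) * δ = (δ.natAbs : ℝ) := by
    rw [← Int.cast_mul, Int.sign_mul_self_eq_natAbs, Int.cast_natCast]
  have hD : (δ.natAbs : ℝ) ≠ 0 := by simpa using hδz
  let b : {j // j ∉ Set.range g} → Fin n → ℝ := fun j => (δ.sign : ℝ) • A.cramerKernelVec f g j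
  have hbV : ∀ j, b j ∈ V := fun j =>
    V.smul_mem _ ((hA _).2 (Matrix.mulVec_cramerKernelVec hdet hmax j))
  have hrec : ∀ α ∈ V, α = (δ.natAbs : ℝ)⁻¹ • ∑ j, α j.1 • b j := by
    intro α hα
    have h1 := Matrix.det_smul_eq_sum_cramerKernelVec hdet hmax ((hA α).1 hα)
    have h2 : ∑ j, α j.1 • b j = (δ.natAbs : ℝ) • α := by
      simp only [b, smul_comm _ (δ.sign : ℝ)]
      rw [← Finset.smul_sum, ← h1, hδ, smul_smul, hs]
    rw [h2, inv_smul_smul₀ hD]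
  have hlin : LinearIndependent ℝ b := by
    rw [Fintype.linearIndependent_iff]
    intro c hc j
    have h1 := congrFun hc j.1
    rw [Finset.sum_apply, Finset.sum_eq_single j] at h1
    · simpa [b, Matrix.cramerKernelVec_apply_of_notMem _ _ _ j.2, hδ, hs, hδz] using h1
    · intro i _ hi
      have : j.1 ≠ i.1 := fun h => hi (Subtype.ext h.symm)
      simp [b, Matrix.cramerKernelVec_apply_of_notMem _ _ _ j.2, this]
    · simp
  have hspan : Submodule.span ℝ (Set.range b) = V := by
    refine le_antisymm (Submodule.span_le.2 (Set.range_subset_iff.2 hbV)) fun α hα => ?_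
    rw [hrec α hα]
    exact Submodule.smul_mem _ _ (Submodule.sum_mem _ fun j _ =>
      Submodule.smul_mem _ _ (Submodule.subset_span ⟨j, rfl⟩))
  have hcard : Fintype.card {j // j ∉ Set.range g} = d := by
    rw [← hdim, ← hspan, finrank_span_eq_card hlin]
  let e : Fin d ≃ {j // j ∉ Set.range g} := (Fintype.equivFinOfCardEq hcard).symm
  refine ⟨b ∘ e, δ.natAbs, fun i => (e i).1, Int.natAbs_pos.2 hδz, fun i => hbV _,
    hlin.comp e e.injective, ?_, fun i x => ?_, fun α hα => ?_⟩
  · rw [e.surjective.range_comp, hspan]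
  · refine ⟨δ.sign * B.cramerKernelVec f g (e i) x, ?_, ?_⟩
    · have hr : r < n := by
        simpa using Fintype.card_lt_of_injective_of_notMem g hg (e i).2
      rw [abs_mul, Int.abs_sign_of_ne_zero hδz, one_mul]
      refine (Matrix.abs_cramerKernelVec_le hB f hg (e i).2 x).trans ?_
      exact pow_le_pow_right₀ (by exact_mod_cast hk) (by omega)
    · have := Matrix.cramerKernelVec_map (Int.castRingHom ℝ) B f g (e i) x
      simp only [Function.comp_apply, b, A, Pi.smul_apply, this, smul_eq_mul, eq_intCast,
        Int.cast_mul]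
  · rw [Function.comp_def, Equiv.sum_comp e fun j => α j.1 • b j]
    exact hrec α hα
end

section
/- Let n ≥ 1, let q > 0, and let α, α′ ∈ [1/2, 2]^n with α ≠ α′. Then the number of σ ∈ {0, 1}^n satisfying ∏ᵢ₌₁ⁿ (1 + q·αᵢ)^{σᵢ} = ∏ᵢ₌₁ⁿ (1 + q·α′ᵢ)^{σᵢ} is at most 2^{n−1}. In other words, the encoding map f : [1/2, 2]^n → ℝ^{2^n}, f(α) = (∏ᵢ (1 + q·αᵢ)^{σᵢ})_{σ ∈ {0,1}^n}, has relative Hamming distance at least 1/2. -/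
open scoped Classical

/-- Flipping a coordinate `i` with `a i ≠ b i` destroys equality of the subset products. -/
theorem prod_ite_update_not_ne {ι K : Type*} [Fintype ι] [DecidableEq ι] [Field K]
    {a b : ι → K} (ha : ∀ j, a j ≠ 0) {i : ι} (hi : a i ≠ b i) {σ : ι → Bool}
    (h : (∏ j, if σ j then a j else 1) = ∏ j, if σ j then b j else 1) :
    (∏ j, if Function.update σ i (!σ i) j then a j else 1) ≠
      ∏ j, if Function.update σ i (!σ i) j then b j else 1 := by
  have split (c : ι → K) (τ : ι → Bool) : (∏ j, if τ j then c j else 1) =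
      (if τ i then c i else 1) * ∏ j ∈ Finset.univ.erase i, if τ j then c j else 1 :=
    (Finset.mul_prod_erase _ _ (Finset.mem_univ i)).symm
  have rest (c : ι → K) :
      (∏ j ∈ Finset.univ.erase i, if Function.update σ i (!σ i) j then c j else 1) =
        ∏ j ∈ Finset.univ.erase i, if σ j then c j else 1 :=
    Finset.prod_congr rfl fun j hj => by
      rw [Function.update_of_ne (Finset.ne_of_mem_erase hj)]
  have hR : (∏ j ∈ Finset.univ.erase i, if σ j then a j else 1) ≠ 0 :=
    Finset.prod_ne_zero_iff.mpr fun j _ => by split_ifs <;> simp [ha j]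
  intro h'
  rw [split, split b] at h
  rw [split, split b, rest, rest, Function.update_self] at h'
  cases hσ : σ i <;> simp only [hσ, Bool.not_true, Bool.not_false, Bool.false_eq_true,
    if_true, if_false, one_mul] at h h'
  · rw [← h] at h'
    exact hi (mul_right_cancel₀ hR h')
  · rw [← h'] at h
    exact hi (mul_right_cancel₀ hR h)

/-- Two distinct families, one of them nowhere zero, have equal subset products for at most
half of all subsets. -/
theorem two_mul_card_prod_ite_eq_le {ι K : Type*} [Fintype ι] [DecidableEq ι] [Field K]
    {a b : ι → K} (ha : ∀ j, a j ≠ 0) (hab : a ≠ b) :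
    2 * (Finset.univ.filter fun σ : ι → Bool =>
      (∏ j, if σ j then a j else 1) = ∏ j, if σ j then b j else 1).card
        ≤ 2 ^ Fintype.card ι := by
  obtain ⟨i, hi⟩ := Function.ne_iff.mp hab
  set A := Finset.univ.filter fun σ : ι → Bool =>
    (∏ j, if σ j then a j else 1) = ∏ j, if σ j then b j else 1 with hA
  have hinv : Function.Involutive fun σ : ι → Bool => Function.update σ i (!σ i) := by
    intro σ
    simp
  have hle : A.card ≤ Aᶜ.card := by
    refine Finset.card_le_card_of_injOn _ (fun σ hσ => ?_) hinv.injective.injOn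
    have hσ' := (Finset.mem_filter.mp hσ).2
    simpa [hA] using prod_ite_update_not_ne ha hi hσ'
  have hcard := A.card_add_card_compl
  rw [Fintype.card_fun, Fintype.card_bool] at hcard
  omega

/-- the multiplicative encoding `α ↦ (∏ᵢ (1 + q·αᵢ)^{σᵢ})_{σ ∈ {0,1}^n}`
has relative Hamming distance at least `1/2`: for distinct `α, α′ ∈ [1/2, 2]^n`, the
encodings agree on at most `2^(n−1)` of the `2^n` coordinates. -/
theorem encoding_distance (n : ℕ) (hn : 1 ≤ n) (q : ℝ) (hq : 0 < q)
    (α α' : Fin n → ℝ)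
    (hα : ∀ i, α i ∈ Set.Icc (1/2 : ℝ) 2) (hα' : ∀ i, α' i ∈ Set.Icc (1/2 : ℝ) 2)
    (hne : α ≠ α') :
    ((Finset.univ.filter (fun σ : Fin n → Bool =>
        (∏ i, if σ i then 1 + q * α i else 1) =
        (∏ i, if σ i then 1 + q * α' i else 1))).card)
      ≤ 2 ^ (n - 1) := by
  have hpos (i : Fin n) : 1 + q * α i ≠ 0 := by
    have : 0 < α i := by linarith [(hα i).1]
    positivity
  have hne' : (fun i => 1 + q * α i) ≠ fun i => 1 + q * α' i := fun h =>
    hne (funext fun i => mul_left_cancel₀ hq.ne' (add_left_cancel (congrFun h i)))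
  have key := two_mul_card_prod_ite_eq_le hpos hne'
  obtain ⟨m, rfl⟩ := Nat.exists_eq_add_of_le' hn
  rw [Fintype.card_fin, pow_succ'] at key
  exact Nat.le_of_mul_le_mul_left key two_pos
end

section
/- Let d ≥ 1 be an integer and let 𝒜(d) denote the subfield of ℝ generated by all real roots of nonzero integer-coefficient polynomials of degree at most d. Then every α ∈ 𝒜(d) is algebraic over ℚ, and every prime factor of the degree [ℚ(α) : ℚ] is at most d. -/
/-- `𝒜(d)`: the subfield of `ℝ` generated by all real roots of nonzero
integer-coefficient polynomials of degree at most `d`. -/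
noncomputable def lowDegreeField (d : ℕ) : Subfield ℝ :=
  Subfield.closure {x : ℝ | ∃ p : Polynomial ℤ, p ≠ 0 ∧ p.natDegree ≤ d ∧
    Polynomial.aeval x p = 0}

/-- The degree of a simple extension `K(x)/K` is at most the degree of any nonzero integer
polynomial vanishing at `x`. -/
theorem finrank_adjoin_simple_le_of_int_root {L : Type*} [Field L] [CharZero L]
    (K : IntermediateField ℚ L) {x : L} {p : Polynomial ℤ} (hp : p ≠ 0)
    (hx : Polynomial.aeval x p = 0) :
    IsIntegral K x ∧
      Module.finrank K (IntermediateField.adjoin K {x} : IntermediateField K L) ≤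
        p.natDegree := by
  have hinj : Function.Injective (algebraMap ℤ K) := (algebraMap ℤ K).injective_int
  have hq : p.map (algebraMap ℤ K) ≠ 0 := (Polynomial.map_ne_zero_iff hinj).2 hp
  have hqx : Polynomial.aeval x (p.map (algebraMap ℤ K)) = 0 := by
    rw [Polynomial.aeval_map_algebraMap, hx]
  have hint : IsIntegral K x := IsAlgebraic.isIntegral ⟨_, hq, hqx⟩
  refine ⟨hint, ?_⟩
  rw [IntermediateField.adjoin.finrank hint]
  exact (Polynomial.natDegree_le_of_dvd (minpoly.dvd K x hqx) hq).trans
    Polynomial.natDegree_map_le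

/-- Adjoining finitely many roots of nonzero integer polynomials of degree at most `d` gives a
finite extension of `ℚ` whose degree has no prime factor above `d`. -/
theorem finrank_adjoin_finset_prime_factors {L : Type*} [Field L] [CharZero L] (d : ℕ)
    (t : Finset L)
    (ht : ∀ x ∈ t, ∃ p : Polynomial ℤ, p ≠ 0 ∧ p.natDegree ≤ d ∧ Polynomial.aeval x p = 0) :
    FiniteDimensional ℚ (IntermediateField.adjoin ℚ (t : Set L)) ∧
    ∀ p : ℕ, p.Prime → p ∣ Module.finrank ℚ (IntermediateField.adjoin ℚ (t : Set L)) →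
      p ≤ d := by
  classical
  induction t using Finset.induction_on with
  | empty =>
    rw [Finset.coe_empty, IntermediateField.adjoin_empty]
    refine ⟨inferInstance, fun p hp h => ?_⟩
    rw [IntermediateField.finrank_bot] at h
    exact absurd (Nat.dvd_one.1 h) hp.ne_one
  | insert x s _ ih =>
    obtain ⟨hfin, hprime⟩ := ih fun y hy => ht y (Finset.mem_insert_of_mem hy)
    obtain ⟨f, hf, hfd, hfx⟩ := ht x (Finset.mem_insert_self x s)
    rw [Finset.coe_insert, Set.insert_eq, Set.union_comm,
      ← IntermediateField.adjoin_adjoin_left]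
    set K := IntermediateField.adjoin ℚ (s : Set L)
    obtain ⟨hint, hle⟩ := finrank_adjoin_simple_le_of_int_root K hf hfx
    have hKx : FiniteDimensional K (IntermediateField.adjoin K {x}) :=
      IntermediateField.adjoin.finiteDimensional hint
    have htower : FiniteDimensional ℚ (IntermediateField.adjoin K {x}) :=
      FiniteDimensional.trans ℚ K _
    refine ⟨htower, fun p hp h => ?_⟩
    have h' : p ∣ Module.finrank ℚ (IntermediateField.adjoin K {x}) := h
    have hmul : Module.finrank ℚ K * Module.finrank K (IntermediateField.adjoin K {x}) =
        Module.finrank ℚ (IntermediateField.adjoin K {x}) :=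
      letI : Module.Free K (IntermediateField.adjoin K {x}) := Module.Free.of_divisionRing K _
      Module.finrank_mul_finrank ℚ K _
    rw [← hmul, hp.dvd_mul] at h'
    rcases h' with h' | h'
    · exact hprime p hp h'
    · exact (Nat.le_of_dvd Module.finrank_pos h').trans (hle.trans hfd)


/-- every `α ∈ 𝒜(d)` is algebraic over `ℚ`, and every prime factor of
`[ℚ(α) : ℚ]` is at most `d`. -/
theorem lowDegreeField_prime_factors (d : ℕ) (hd : 1 ≤ d) (α : ℝ)
    (hα : α ∈ lowDegreeField d) :
    IsAlgebraic ℚ α ∧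
    ∀ p : ℕ, p.Prime →
      p ∣ Module.finrank ℚ (IntermediateField.adjoin ℚ {α} : IntermediateField ℚ ℝ) →
      p ≤ d := by
  have hmem : α ∈ IntermediateField.adjoin ℚ {x : ℝ | ∃ p : Polynomial ℤ, p ≠ 0 ∧
      p.natDegree ≤ d ∧ Polynomial.aeval x p = 0} := by
    have hle : lowDegreeField d ≤ (IntermediateField.adjoin ℚ {x : ℝ | ∃ p : Polynomial ℤ,
        p ≠ 0 ∧ p.natDegree ≤ d ∧ Polynomial.aeval x p = 0}).toSubfield :=
      Subfield.closure_le.2 (IntermediateField.subset_adjoin ℚ _)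
    exact hle hα
  obtain ⟨t, ht, hαt⟩ := IntermediateField.exists_finset_of_mem_adjoin hmem
  obtain ⟨hfin, hprime⟩ := finrank_adjoin_finset_prime_factors d t fun x hx => ht hx
  refine ⟨?_, fun p hp h => hprime p hp (h.trans ?_)⟩
  · exact (IntermediateField.isAlgebraic_iff.1
      (Algebra.IsAlgebraic.isAlgebraic (R := ℚ)
        (⟨α, hαt⟩ : IntermediateField.adjoin ℚ (t : Set ℝ))))
  · exact IntermediateField.finrank_dvd_of_le_right
      (IntermediateField.adjoin_simple_le_iff.2 hαt)
end

section
/- Let p be a prime number and let d be a natural number with d < p. Then the real number 2^{1/p} (the positive real p-th root of 2) does not belong to 𝒜(d). -/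
/-- No rational number has `p`-th power equal to `2` when `p` is prime. -/
theorem rat_pow_prime_ne_two {p : ℕ} (hp : p.Prime) (b : ℚ) : b ^ p ≠ 2 := by
  intro h
  have hv := congrArg (padicValRat 2) h
  have h2 : padicValRat 2 (2 : ℚ) = 1 := by
    exact_mod_cast padicValRat.self (p := 2) one_lt_two
  rw [padicValRat.pow, h2] at hv
  have hdvd : (p : ℤ) ∣ 1 := ⟨_, hv.symm⟩
  exact hp.one_lt.ne' (Nat.dvd_one.mp (by exact_mod_cast hdvd))

/-- The real number `2^(1/p)` has degree `p` over `ℚ` when `p` is prime. -/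
theorem natDegree_minpoly_two_rpow_inv {p : ℕ} (hp : p.Prime) :
    (minpoly ℚ ((2 : ℝ) ^ ((p : ℝ)⁻¹))).natDegree = p := by
  have hroot : ((2 : ℝ) ^ ((p : ℝ)⁻¹)) ^ p = 2 :=
    Real.rpow_inv_natCast_pow zero_le_two hp.ne_zero
  rw [← minpoly.eq_of_irreducible_of_monic
    (X_pow_sub_C_irreducible_of_prime hp (rat_pow_prime_ne_two hp))
    (by simp [hroot]) (Polynomial.monic_X_pow_sub_C _ hp.ne_zero)]
  exact Polynomial.natDegree_X_pow_sub_C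

/-- Adjoining finitely many real numbers, each a root of a nonzero integer polynomial of degree
less than the prime `p`, gives a number field of degree prime to `p`. -/
theorem not_dvd_finrank_adjoin {p : ℕ} (hp : p.Prime) (s : Finset ℝ)
    (hs : ∀ x ∈ s, ∃ q : Polynomial ℤ, q ≠ 0 ∧ q.natDegree < p ∧ Polynomial.aeval x q = 0) :
    ¬ p ∣ Module.finrank ℚ (IntermediateField.adjoin ℚ (s : Set ℝ)) := by
  induction s using Finset.induction_on with
  | empty =>
    rw [Finset.coe_empty, IntermediateField.adjoin_empty, IntermediateField.finrank_bot]
    exact hp.not_dvd_one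
  | insert x s _ ih =>
    obtain ⟨q, hq0, hqd, hqx⟩ := hs x (Finset.mem_insert_self x s)
    have ih := ih fun y hy => hs y (Finset.mem_insert_of_mem hy)
    set K := IntermediateField.adjoin ℚ (s : Set ℝ)
    have hinj : Function.Injective (algebraMap ℤ K) := (algebraMap ℤ K).injective_int
    have hmap0 : q.map (algebraMap ℤ K) ≠ 0 := (Polynomial.map_ne_zero_iff hinj).mpr hq0
    have hmapx : Polynomial.aeval x (q.map (algebraMap ℤ K)) = 0 := by
      rwa [Polynomial.aeval_map_algebraMap]
    have hint : IsIntegral K x := IsAlgebraic.isIntegral ⟨_, hmap0, hmapx⟩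
    have hle : (minpoly K x).natDegree < p :=
      ((Polynomial.natDegree_le_of_dvd (minpoly.dvd K x hmapx) hmap0).trans
        Polynomial.natDegree_map_le).trans_lt hqd
    have hadj : IntermediateField.adjoin ℚ ((insert x s : Finset ℝ) : Set ℝ) =
        (IntermediateField.adjoin K {x}).restrictScalars ℚ := by
      rw [Finset.coe_insert, ← Set.union_singleton]
      exact (IntermediateField.adjoin_adjoin_left ℚ (s : Set ℝ) {x}).symm
    have hmul : Module.finrank ℚ K * Module.finrank K (IntermediateField.adjoin K {x}) =
        Module.finrank ℚ ((IntermediateField.adjoin K {x}).restrictScalars ℚ) :=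
      Module.finrank_mul_finrank ℚ K (IntermediateField.adjoin K {x})
    rw [hadj, ← hmul, IntermediateField.adjoin.finrank hint, hp.dvd_mul]
    exact not_or.mpr ⟨ih, Nat.not_dvd_of_pos_of_lt (minpoly.natDegree_pos hint) hle⟩

/-- for a prime `p` and `d < p`, the real number `2^(1/p)` is not in
`𝒜(d)`. -/
theorem root_two_not_in_lowDegreeField (p : ℕ) (hp : p.Prime) (d : ℕ) (hd : d < p) :
    (2 : ℝ) ^ ((p : ℝ)⁻¹) ∉ lowDegreeField d := by
  intro h
  set S : Set ℝ := {x : ℝ | ∃ p : Polynomial ℤ, p ≠ 0 ∧ p.natDegree ≤ d ∧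
    Polynomial.aeval x p = 0}
  have hS : lowDegreeField d ≤ (IntermediateField.adjoin ℚ S).toSubfield :=
    Subfield.closure_le.mpr (IntermediateField.subset_adjoin ℚ S)
  obtain ⟨s, hsS, hs⟩ := IntermediateField.exists_finset_of_mem_adjoin (hS h)
  refine not_dvd_finrank_adjoin hp s (fun x hx => ?_) ?_
  · obtain ⟨q, hq0, hqd, hqx⟩ := hsS hx
    exact ⟨q, hq0, hqd.trans_lt hd, hqx⟩
  · have hdeg : (minpoly ℚ (⟨_, hs⟩ : IntermediateField.adjoin ℚ (s : Set ℝ))).natDegree = p :=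
      (congrArg Polynomial.natDegree (IntermediateField.minpoly_eq _)).trans
        (natDegree_minpoly_two_rpow_inv hp)
    have hint : IsIntegral ℚ (⟨_, hs⟩ : IntermediateField.adjoin ℚ (s : Set ℝ)) :=
      minpoly.ne_zero_iff.mp (Polynomial.ne_zero_of_natDegree_gt (hdeg ▸ hp.pos))
    rw [← hdeg]
    exact minpoly.degree_dvd hint
end

section
/- For every q > 0 and every natural number k, there exists an ETR-C(q) instance φ over a finite variable set V with n = |V| variables such that some assignment f : V → [1/2, 2] satisfies all constraints of φ, but no assignment f : V → 𝒜(n^k) ∩ [1/2, 2] satisfies all constraints of φ. -/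
/-- An ETR-C(q) constraint over a variable set `V`: `x = y`, `x = (1+q)·y`,
`x + y = z`, `x + y = z + w`, `x·y = z`, or `x·y = z·w`. -/
inductive EtrC (V : Type) : Type where
  | eq : V → V → EtrC V
  | eqQ : V → V → EtrC V
  | add : V → V → V → EtrC V
  | add4 : V → V → V → V → EtrC V
  | mul : V → V → V → EtrC V
  | mul4 : V → V → V → V → EtrC V

/-- Satisfaction of an ETR-C(q) constraint by an assignment `f`. -/
def EtrC.Sat {V : Type} (q : ℝ) (f : V → ℝ) : EtrC V → Prop
  | .eq x y => f x = f y
  | .eqQ x y => f x = (1 + q) * f y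
  | .add x y z => f x + f y = f z
  | .add4 x y z w => f x + f y = f z + f w
  | .mul x y z => f x * f y = f z
  | .mul4 x y z w => f x * f y = f z * f w

open Polynomial in
/-- A prime `p > d` stays away from the degrees of the number fields needed to contain a given
element of `lowDegreeField d`. -/
theorem exists_intermediateField_of_mem_lowDegreeField {d p : ℕ} (hp : p.Prime) (hd : d < p)
    {a : ℝ} (ha : a ∈ lowDegreeField d) (F : IntermediateField ℚ ℝ)
    (hF : ¬ p ∣ Module.finrank ℚ F) :
    ∃ K : IntermediateField ℚ ℝ, F ≤ K ∧ a ∈ K ∧ ¬ p ∣ Module.finrank ℚ K := by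
  induction ha using Subfield.closure_induction generalizing F with
  | mem x hx =>
    obtain ⟨P, hP0, hPd, hPx⟩ := hx
    have hinj : Function.Injective (algebraMap ℤ F) := (algebraMap ℤ F).injective_int
    have hP0' : P.map (algebraMap ℤ F) ≠ 0 := (Polynomial.map_ne_zero_iff hinj).2 hP0
    have hroot : aeval x (P.map (algebraMap ℤ F)) = 0 := by
      rwa [aeval_map_algebraMap]
    have hint : IsIntegral F x := IsAlgebraic.isIntegral ⟨_, hP0', hroot⟩
    have hdeg : (minpoly F x).natDegree ≤ d :=
      (natDegree_le_of_dvd (minpoly.dvd F x hroot) hP0').trans (natDegree_map_le.trans hPd)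
    refine ⟨(IntermediateField.adjoin F {x}).restrictScalars ℚ, fun y hy => ?_, ?_, ?_⟩
    · exact (IntermediateField.adjoin F {x}).algebraMap_mem ⟨y, hy⟩
    · exact IntermediateField.mem_adjoin_simple_self F x
    · have hmul := Module.finrank_mul_finrank ℚ F (IntermediateField.adjoin F {x})
      rw [IntermediateField.adjoin.finrank hint] at hmul
      change ¬ p ∣ Module.finrank ℚ (IntermediateField.adjoin F {x})
      rw [← hmul, hp.dvd_mul]
      rintro (h | h)
      · exact hF h
      · exact absurd (Nat.le_of_dvd (minpoly.natDegree_pos hint) h) (by omega)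
  | one => exact ⟨F, le_rfl, F.one_mem, hF⟩
  | add x y _ _ ihx ihy =>
    obtain ⟨K, hFK, hxK, hK⟩ := ihx F hF
    obtain ⟨L, hKL, hyL, hL⟩ := ihy K hK
    exact ⟨L, hFK.trans hKL, L.add_mem (hKL hxK) hyL, hL⟩
  | neg x _ ih =>
    obtain ⟨K, hFK, hxK, hK⟩ := ih F hF
    exact ⟨K, hFK, K.neg_mem hxK, hK⟩
  | inv x _ ih =>
    obtain ⟨K, hFK, hxK, hK⟩ := ih F hF
    exact ⟨K, hFK, K.inv_mem hxK, hK⟩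
  | mul x y _ _ ihx ihy =>
    obtain ⟨K, hFK, hxK, hK⟩ := ihx F hF
    obtain ⟨L, hKL, hyL, hL⟩ := ihy K hK
    exact ⟨L, hFK.trans hKL, L.mul_mem (hKL hxK) hyL, hL⟩

open Polynomial in
theorem notMem_lowDegreeField_of_pow_prime_eq_two {d p : ℕ} (hp : p.Prime) (hd : d < p)
    {x : ℝ} (hx : x ^ p = 2) : x ∉ lowDegreeField d := by
  intro hmem
  obtain ⟨K, -, hxK, hK⟩ := exists_intermediateField_of_mem_lowDegreeField hp hd hmem ⊥
    (by rw [IntermediateField.finrank_bot]; exact hp.one_lt.ne' ∘ Nat.dvd_one.1)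
  have hirr : Irreducible (X ^ p - C (2 : ℚ)) :=
    X_pow_sub_C_irreducible_of_prime hp (rat_pow_prime_ne_two hp)
  have hmin : minpoly ℚ x = X ^ p - C (2 : ℚ) :=
    (minpoly.eq_of_irreducible_of_monic hirr (by simp [hx])
      (monic_X_pow_sub_C _ hp.ne_zero)).symm
  have : FiniteDimensional ℚ K := Module.finite_of_finrank_pos
    (Nat.pos_of_ne_zero fun h => hK (h ▸ dvd_zero p))
  have hdvd := minpoly.degree_dvd (K := ℚ) (x := (⟨x, hxK⟩ : K)) (Algebra.IsIntegral.isIntegral _)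
  have hmap : minpoly ℚ (⟨x, hxK⟩ : K) = minpoly ℚ x :=
    (minpoly.algebraMap_eq (algebraMap K ℝ).injective (⟨x, hxK⟩ : K)).symm
  rw [hmap, hmin, natDegree_X_pow_sub_C] at hdvd
  exact hK hdvd

theorem exists_add_five_pow_le_two_pow (k : ℕ) : ∃ m : ℕ, (m + 5) ^ k ≤ 2 ^ m := by
  have h := tendsto_pow_const_div_const_pow_of_one_lt k (r := (2 : ℝ)) (by norm_num)
  have h' := h.eventually (gt_mem_nhds (show (0 : ℝ) < 1 / 2 ^ 5 by norm_num))
  obtain ⟨n, hn, hn5⟩ := (h'.and (Filter.eventually_ge_atTop 5)).exists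
  obtain ⟨m, rfl⟩ := Nat.exists_eq_add_of_le' hn5
  refine ⟨m, ?_⟩
  rw [div_lt_div_iff₀ (by positivity) (by positivity), one_mul, pow_add] at hn
  have := lt_of_mul_lt_mul_right hn (by positivity)
  exact_mod_cast this.le

/-- The exponentiation-by-squaring step on the variables `y₀, …, y_L, x, x⁻¹` of the instance:
`y_j` stands for `x ^ (p / 2 ^ j)`. -/
def squaringConstraint (p L : ℕ) (j : Fin L) : EtrC (Fin (L + 3)) :=
  if p / 2 ^ (j : ℕ) % 2 = 0 then
    .mul ⟨j + 1, by omega⟩ ⟨j + 1, by omega⟩ ⟨j, by omega⟩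
  else
    .mul4 ⟨j + 1, by omega⟩ ⟨j + 1, by omega⟩ ⟨j, by omega⟩ ⟨L + 2, by omega⟩

/-- An instance expressing `x ^ p = 2` when `p < 2 ^ L`. -/
def powEqTwoInstance (p L : ℕ) : Multiset (EtrC (Fin (L + 3))) :=
  .mul ⟨L, by omega⟩ ⟨L, by omega⟩ ⟨L, by omega⟩ ::ₘ
  .add ⟨L, by omega⟩ ⟨L, by omega⟩ ⟨0, by omega⟩ ::ₘ
  .mul ⟨L + 1, by omega⟩ ⟨L + 2, by omega⟩ ⟨L, by omega⟩ ::ₘ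
  (Finset.univ : Finset (Fin L)).val.map (squaringConstraint p L)

theorem powEqTwoInstance_sat_iff {q : ℝ} {p L : ℕ} {f : Fin (L + 3) → ℝ} :
    (∀ c ∈ powEqTwoInstance p L, EtrC.Sat q f c) ↔
      f ⟨L, by omega⟩ * f ⟨L, by omega⟩ = f ⟨L, by omega⟩ ∧
      f ⟨L, by omega⟩ + f ⟨L, by omega⟩ = f ⟨0, by omega⟩ ∧
      f ⟨L + 1, by omega⟩ * f ⟨L + 2, by omega⟩ = f ⟨L, by omega⟩ ∧
      ∀ j : Fin L, EtrC.Sat q f (squaringConstraint p L j) := by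
  simp [powEqTwoInstance, EtrC.Sat]

theorem pow_eq_two_of_sat {q : ℝ} {p L : ℕ} (hpL : p < 2 ^ L) {f : Fin (L + 3) → ℝ}
    (hf : ∀ v, f v ≠ 0) (hsat : ∀ c ∈ powEqTwoInstance p L, EtrC.Sat q f c) :
    f ⟨L + 1, by omega⟩ ^ p = 2 := by
  obtain ⟨hone, htwo, hinv, hstep⟩ := powEqTwoInstance_sat_iff.1 hsat
  have hL : f ⟨L, by omega⟩ = 1 := mul_right_cancel₀ (hf _) (by rw [hone, one_mul])
  rw [hL] at hinv htwo
  have hpow : ∀ i, ∀ hi : i ≤ L,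
      f ⟨L - i, by omega⟩ = f ⟨L + 1, by omega⟩ ^ (p / 2 ^ (L - i)) := by
    intro i
    induction i with
    | zero => intro _; simpa [Nat.div_eq_of_lt hpL] using hL
    | succ i ih =>
      intro hi
      obtain ⟨j, rfl⟩ : ∃ j, L = j + (i + 1) := Nat.exists_eq_add_of_le' hi
      have h1 := ih (by omega)
      simp only [show j + (i + 1) - i = j + 1 by omega, pow_succ 2 j,
        ← Nat.div_div_eq_div_mul] at h1
      simp only [Nat.add_sub_cancel]
      have h2 := hstep ⟨j, by omega⟩
      have hdm := Nat.div_add_mod (p / 2 ^ j) 2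
      unfold squaringConstraint at h2
      dsimp only at h2
      generalize p / 2 ^ j = r at h1 h2 hdm ⊢
      split_ifs at h2 with h <;> simp only [EtrC.Sat] at h2 <;> rw [h1, ← pow_add] at h2
      · rw [← h2]
        congr 1
        omega
      · refine mul_right_cancel₀ (hf ⟨j + (i + 1) + 2, by omega⟩) ?_
        rw [← h2, show r = r / 2 + r / 2 + 1 by omega, pow_succ, mul_assoc, hinv, mul_one]
        congr 1
        omega
  have h := hpow L le_rfl
  simp only [Nat.sub_self, pow_zero, Nat.div_one] at h
  rw [← h, ← htwo, one_add_one_eq_two]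

theorem exists_sat_powEqTwoInstance (q : ℝ) {p L : ℕ} (hp : p ≠ 0) (hpL : p < 2 ^ L) :
    ∃ f : Fin (L + 3) → ℝ, (∀ v, f v ∈ Set.Icc (1/2 : ℝ) 2) ∧
      ∀ c ∈ powEqTwoInstance p L, EtrC.Sat q f c := by
  obtain ⟨x, hx0, hxp⟩ : ∃ x : ℝ, 0 ≤ x ∧ x ^ p = 2 :=
    ⟨2 ^ (p : ℝ)⁻¹, by positivity, Real.rpow_inv_natCast_pow (by norm_num) hp⟩
  have hx1 : 1 ≤ x := by
    by_contra! h
    have := pow_le_one₀ (n := p) hx0 h.le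
    linarith
  have hle : ∀ r ≤ p, x ^ r ∈ Set.Icc (1/2 : ℝ) 2 := fun r hr =>
    ⟨by linarith [one_le_pow₀ hx1 (n := r)], hxp ▸ pow_le_pow_right₀ hx1 hr⟩
  have hx2 : x ∈ Set.Icc (1/2 : ℝ) 2 := by
    simpa using hle 1 (Nat.one_le_iff_ne_zero.2 hp)
  have hinv : x⁻¹ ∈ Set.Icc (1/2 : ℝ) 2 := by
    refine ⟨?_, (inv_le_one_of_one_le₀ hx1).trans one_le_two⟩
    rw [one_div]
    exact inv_anti₀ (by linarith) hx2.2
  refine ⟨fun v => if (v : ℕ) ≤ L then x ^ (p / 2 ^ (v : ℕ)) else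
    if (v : ℕ) = L + 1 then x else x⁻¹, fun v => ?_, powEqTwoInstance_sat_iff.2 ?_⟩
  · dsimp only
    split_ifs
    exacts [hle _ (Nat.div_le_self _ _), hx2, hinv]
  · have hx : x ≠ 0 := by linarith
    refine ⟨by simp [Nat.div_eq_of_lt hpL], ?_, by simp [Nat.div_eq_of_lt hpL, hx], fun j => ?_⟩
    · simp [Nat.div_eq_of_lt hpL, hxp, one_add_one_eq_two]
    · have hj := j.2
      have hdm := Nat.div_add_mod (p / 2 ^ (j : ℕ)) 2
      have hdd : p / 2 ^ ((j : ℕ) + 1) = p / 2 ^ (j : ℕ) / 2 := by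
        rw [pow_succ, Nat.div_div_eq_div_mul]
      unfold squaringConstraint
      split_ifs with h
      · simp only [EtrC.Sat, Nat.succ_le_of_lt hj, hj.le, if_true, hdd, ← pow_add]
        congr 1
        omega
      · simp only [EtrC.Sat, Nat.succ_le_of_lt hj, hj.le, if_true, hdd, ← pow_add]
        simp
        rw [eq_mul_inv_iff_mul_eq₀ hx, ← pow_succ]
        congr 1
        omega

/-- for every `q > 0` and `k` there is an ETR-C(q) instance on `n`
variables that is satisfiable over `[1/2, 2]`, but not satisfiable by any assignment
with all values in `𝒜(n^k) ∩ [1/2, 2]`. -/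
theorem etrC_not_satisfiable_low_degree (q : ℝ) (hq : 0 < q) (k : ℕ) :
    ∃ (n : ℕ) (φ : Multiset (EtrC (Fin n))),
      (∃ f : Fin n → ℝ, (∀ v, f v ∈ Set.Icc (1/2 : ℝ) 2) ∧ ∀ c ∈ φ, EtrC.Sat q f c) ∧
      ¬ ∃ f : Fin n → ℝ,
          (∀ v, f v ∈ Set.Icc (1/2 : ℝ) 2 ∧ f v ∈ lowDegreeField (n ^ k)) ∧
          ∀ c ∈ φ, EtrC.Sat q f c := by
  obtain ⟨m, hm⟩ := exists_add_five_pow_le_two_pow k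
  obtain ⟨p, hp, hmp, hpm⟩ := Nat.exists_prime_lt_and_le_two_mul (2 ^ m) (by positivity)
  have hpL : p < 2 ^ (m + 2) := by
    have : 0 < 2 ^ m := by positivity
    rw [pow_add]
    omega
  refine ⟨m + 2 + 3, powEqTwoInstance p (m + 2), exists_sat_powEqTwoInstance q hp.ne_zero hpL, ?_⟩
  rintro ⟨f, hf, hsat⟩
  have hx := pow_eq_two_of_sat hpL (fun v => by linarith [(hf v).1.1]) hsat
  exact notMem_lowDegreeField_of_pow_prime_eq_two hp (hm.trans_lt hmp) hx (hf _).2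
end

section
/- Let φ be a finite multiset of ETR-INV constraints over a finite variable set V, and let A ⊆ φ be the sub-multiset of constraints that are not of the form x + y = x or x + x = x (i.e., addition constraints in which the output variable coincides with one of the summands). Then (i) no assignment f : V → [1/2, 2] satisfies any constraint of the form x + y = x or x + x = x, and (ii) there exists an assignment f : V → {1, 2} that satisfies at least |A|/8 of the constraints of φ. -/
open scoped Classical

/-- A degenerate addition constraint: of the form `x + y = x` or `x + x = x`,
i.e. an addition constraint whose output variable coincides with one of the summands. -/
def EtrInv.Degenerate {V : Type} : EtrInv V → Prop
  | .add x y z => z = x ∨ z = y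
  | _ => False

/-- The `{1, 2}`-valued assignment encoded by a Boolean function. -/
noncomputable def boolAssignment {V : Type} (g : V → Bool) : V → ℝ :=
  fun v => if g v then 2 else 1

/-- A property of Boolean functions that is implied by prescribing the values at three points
holds for at least one eighth of all Boolean functions. -/
theorem card_fun_bool_le_eight_mul {V : Type} [Fintype V] (P : (V → Bool) → Prop)
    (t : V → Bool) (x y z : V)
    (h : ∀ g : V → Bool, g x = t x → g y = t y → g z = t z → P g) :
    Fintype.card (V → Bool) ≤ 8 * (Finset.univ.filter P).card := by
  let u : (V → Bool) → (V → Bool) := fun g v => if v = x ∨ v = y ∨ v = z then t v else g v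
  have key : (Finset.univ : Finset (V → Bool)).card ≤
      ((Finset.univ.filter P) ×ˢ (Finset.univ : Finset (Bool × Bool × Bool))).card := by
    refine Finset.card_le_card_of_injOn (fun g => (u g, g x, g y, g z)) ?_ ?_
    · intro g _
      have hu : P (u g) := h _ (by simp [u]) (by simp [u]) (by simp [u])
      simpa using hu
    · intro g _ g' _ hg
      simp only [Prod.mk.injEq] at hg
      obtain ⟨hu, hx, hy, hz⟩ := hg
      funext v
      by_cases hv : v = x ∨ v = y ∨ v = z
      · rcases hv with rfl | rfl | rfl <;> assumption
      · simpa [u, hv] using congrFun hu v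
  rw [Finset.card_product] at key
  simp only [Finset.card_univ, Fintype.card_prod, Fintype.card_bool] at key ⊢
  omega

/-- A non-degenerate constraint is satisfied by at least one eighth of the `{1, 2}`-valued
assignments. -/
theorem EtrInv.card_le_eight_mul_card_sat {V : Type} [Fintype V] (c : EtrInv V)
    (hc : ¬ c.Degenerate) :
    Fintype.card (V → Bool) ≤
      8 * (Finset.univ.filter fun g : V → Bool => c.Sat (boolAssignment g)).card := by
  cases c with
  | one x =>
    refine card_fun_bool_le_eight_mul _ (fun _ => false) x x x fun g hx _ _ => ?_
    simp [EtrInv.Sat, boolAssignment, hx]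
  | inv x y =>
    refine card_fun_bool_le_eight_mul _ (fun _ => false) x y y fun g hx hy _ => ?_
    simp [EtrInv.Sat, boolAssignment, hx, hy]
  | add x y z =>
    simp only [EtrInv.Degenerate, not_or] at hc
    refine card_fun_bool_le_eight_mul _ (fun v => decide (v = z)) x y z fun g hx hy hz => ?_
    simp only [Ne.symm hc.1, Ne.symm hc.2, decide_false, decide_true] at hx hy hz
    simp only [EtrInv.Sat, boolAssignment, hx, hy, hz]
    norm_num

/-- Double counting: summed over all `{1, 2}`-valued assignments, the number of satisfied
constraints is at least one eighth of the number of non-degenerate ones per assignment. -/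
theorem EtrInv.card_mul_card_le_sum_card_sat {V : Type} [Fintype V] (φ : Multiset (EtrInv V)) :
    Fintype.card (V → Bool) * (φ.filter fun c => ¬ c.Degenerate).card ≤
      ∑ g : V → Bool, 8 * (φ.filter fun c => c.Sat (boolAssignment g)).card := by
  induction φ using Multiset.induction_on with
  | empty => simp
  | cons c φ ih =>
    have hsum : ∑ g : V → Bool, 8 * ((c ::ₘ φ).filter fun c => c.Sat (boolAssignment g)).card =
        8 * (Finset.univ.filter fun g : V → Bool => c.Sat (boolAssignment g)).card +
          ∑ g : V → Bool, 8 * (φ.filter fun c => c.Sat (boolAssignment g)).card := by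
      rw [Finset.card_filter, Finset.mul_sum, ← Finset.sum_add_distrib]
      refine Finset.sum_congr rfl fun g _ => ?_
      by_cases hg : c.Sat (boolAssignment g)
      · simp [hg, mul_add, add_comm]
      · simp [hg]
    rw [hsum]
    by_cases hc : c.Degenerate
    · rw [Multiset.filter_cons_of_neg (p := fun c : EtrInv V => ¬ c.Degenerate) φ (not_not.mpr hc)]
      exact ih.trans (Nat.le_add_left _ _)
    · rw [Multiset.filter_cons_of_pos (p := fun c : EtrInv V => ¬ c.Degenerate) φ hc,
        Multiset.card_cons, mul_add, mul_one, add_comm]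
      exact add_le_add (c.card_le_eight_mul_card_sat hc) ih

/-- (i) no assignment into `[1/2, 2]` satisfies a degenerate addition
constraint, and (ii) there is an assignment into `{1, 2}` satisfying at least `|A|/8`
constraints, where `A` is the sub-multiset of non-degenerate constraints. -/
theorem etr_inv_eight_approximation {V : Type} [Fintype V]
    (φ : Multiset (EtrInv V)) :
    (∀ f : V → ℝ, (∀ v, f v ∈ Set.Icc (1/2 : ℝ) 2) →
      ∀ c ∈ φ, EtrInv.Degenerate c → ¬ EtrInv.Sat f c) ∧
    (∃ f : V → ℝ, (∀ v, f v = 1 ∨ f v = 2) ∧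
      ((φ.filter (fun c => ¬ EtrInv.Degenerate c)).card : ℝ) / 8 ≤
        ((φ.filter (fun c => EtrInv.Sat f c)).card : ℝ)) := by
  refine ⟨fun f hf c _ hd hs => ?_, ?_⟩
  · cases c with
    | one x => exact hd
    | inv x y => exact hd
    | add x y z =>
      have hx := (hf x).1
      have hy := (hf y).1
      simp only [EtrInv.Sat] at hs
      rcases hd with rfl | rfl <;> linarith
  · obtain ⟨g, -, hg⟩ := Finset.exists_le_of_sum_le (s := (Finset.univ : Finset (V → Bool)))
      (f := fun _ => (φ.filter fun c => ¬ c.Degenerate).card)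
      (g := fun g => 8 * (φ.filter fun c => c.Sat (boolAssignment g)).card)
      Finset.univ_nonempty (by simpa using EtrInv.card_mul_card_le_sum_card_sat φ)
    refine ⟨boolAssignment g, fun v => ?_, ?_⟩
    · cases h : g v <;> simp [boolAssignment, h]
    · rw [div_le_iff₀ (by norm_num), mul_comm]
      exact_mod_cast hg
end

section
/- Let q > 0 and let V ⊆ [1/2, 2]^4 be one of the constraint sets in 𝒞(q). Then there exists a set V′ ⊆ ℝ^{74} that is the intersection of finitely many sets, of which at most 1 is of the form {α ∈ ℝ^{74} : αᵢ = q}, at most 52 are of the form {α ∈ ℝ^{74} : αᵢ + αⱼ = α_k}, and at most 18 are of the form {α ∈ ℝ^{74} : (1 + αᵢ)(1 + αⱼ) = 1 + α_k} (with indices i, j, k ∈ {1, …, 74} not necessarily distinct), such that: (i) for every x ∈ V there exists y ∈ [−6q, 6q]^{70} with (q·x, y) ∈ V′; and (ii) for every (x, y) ∈ V′ with x ∈ ℝ^4 and y ∈ ℝ^{70}, one has q^{−1}·x ∈ V. -/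
/-- The collection `𝒞(q)` of constraint subsets of `[1/2, 2]^4` (coordinates
`(x, y, z, w) = (v 0, v 1, v 2, v 3)`): `x = y`, `x = (1+q)y`, `x + y = z`,
`x + y = z + w`, `x·y = z`, `x·y = z·w`, and the null constraint. -/
def CqSets (q : ℝ) : Set (Set (Fin 4 → ℝ)) :=
  { {v | (∀ i, v i ∈ Set.Icc (1/2 : ℝ) 2) ∧ v 0 = v 1},
    {v | (∀ i, v i ∈ Set.Icc (1/2 : ℝ) 2) ∧ v 0 = (1 + q) * v 1},
    {v | (∀ i, v i ∈ Set.Icc (1/2 : ℝ) 2) ∧ v 0 + v 1 = v 2},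
    {v | (∀ i, v i ∈ Set.Icc (1/2 : ℝ) 2) ∧ v 0 + v 1 = v 2 + v 3},
    {v | (∀ i, v i ∈ Set.Icc (1/2 : ℝ) 2) ∧ v 0 * v 1 = v 2},
    {v | (∀ i, v i ∈ Set.Icc (1/2 : ℝ) 2) ∧ v 0 * v 1 = v 2 * v 3},
    {v | ∀ i, v i ∈ Set.Icc (1/2 : ℝ) 2} }

/-- A "shrunk" constraint over an index type `ι`: `αᵢ = q`, `αᵢ + αⱼ = α_k`, or
`(1 + αᵢ)(1 + αⱼ) = 1 + α_k`. -/
inductive Shrunk (ι : Type) : Type where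
  | const : ι → Shrunk ι
  | add : ι → ι → ι → Shrunk ι
  | mul : ι → ι → ι → Shrunk ι

/-- Satisfaction of a shrunk constraint. -/
def Shrunk.Sat {ι : Type} (q : ℝ) (α : ι → ℝ) : Shrunk ι → Prop
  | .const i => α i = q
  | .add i j k => α i + α j = α k
  | .mul i j k => (1 + α i) * (1 + α j) = 1 + α k

def Shrunk.isConst {ι : Type} : Shrunk ι → Bool
  | .const _ => true
  | _ => false

def Shrunk.isAdd {ι : Type} : Shrunk ι → Bool
  | .add _ _ _ => true
  | _ => false

def Shrunk.isMul {ι : Type} : Shrunk ι → Bool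
  | .mul _ _ _ => true
  | _ => false

namespace Shrunk

/-- Renaming the variables of a shrunk constraint. -/
def map {ι κ : Type} (f : ι → κ) : Shrunk ι → Shrunk κ
  | .const i => .const (f i)
  | .add i j k => .add (f i) (f j) (f k)
  | .mul i j k => .mul (f i) (f j) (f k)

variable {ι κ : Type}

theorem sat_map (f : ι → κ) (q : ℝ) (α : κ → ℝ) (c : Shrunk ι) :
    (c.map f).Sat q α ↔ c.Sat q (α ∘ f) := by
  cases c <;> rfl

theorem isConst_comp_map (f : ι → κ) : isConst ∘ map f = isConst := by
  funext c; cases c <;> rfl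

theorem isAdd_comp_map (f : ι → κ) : isAdd ∘ map f = isAdd := by
  funext c; cases c <;> rfl

theorem isMul_comp_map (f : ι → κ) : isMul ∘ map f = isMul := by
  funext c; cases c <;> rfl

/-- Constraints expressing `α r = α a * α b`, with auxiliary variables `s` for `α a + α b`
and `p` for `α a + α b + α a * α b`. -/
def product (a b r s p : ι) : List (Shrunk ι) :=
  [.add a b s, .add r s p, .mul a b p]

theorem forall_mem_product_sat {q : ℝ} {α : ι → ℝ} {a b r s p : ι} :
    (∀ c ∈ product a b r s p, c.Sat q α) ↔
      α s = α a + α b ∧ α p = α r + α s ∧ α r = α a * α b := by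
  simp only [product, List.forall_mem_cons, List.not_mem_nil, false_imp_iff, implies_true,
    and_true, Sat]
  constructor
  · rintro ⟨h₁, h₂, h₃⟩
    exact ⟨h₁.symm, h₂.symm, by linarith⟩
  · rintro ⟨h₁, h₂, h₃⟩
    exact ⟨h₁.symm, h₂.symm, by linarith⟩

end Shrunk

/-- The auxiliary variables may be indexed by any type with at most `70` elements. -/
theorem exists_shrunk_of_card_le {κ : Type} [Fintype κ] (hκ : Fintype.card κ ≤ 70)
    {q : ℝ} (hq : 0 < q) {V : Set (Fin 4 → ℝ)} (cs : List (Shrunk (Fin 4 ⊕ κ)))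
    (hconst : cs.countP Shrunk.isConst ≤ 1) (hadd : cs.countP Shrunk.isAdd ≤ 52)
    (hmul : cs.countP Shrunk.isMul ≤ 18)
    (hcomplete : ∀ x ∈ V, ∃ y : κ → ℝ, (∀ j, y j ∈ Set.Icc (-(6 * q)) (6 * q)) ∧
      ∀ c ∈ cs, c.Sat q (Sum.elim (fun i => q * x i) y))
    (hsound : ∀ α : Fin 4 ⊕ κ → ℝ, (∀ c ∈ cs, c.Sat q α) →
      (fun i => q⁻¹ * α (Sum.inl i)) ∈ V) :
    ∃ (cs : List (Shrunk (Fin 4 ⊕ Fin 70))) (V' : Set ((Fin 4 ⊕ Fin 70) → ℝ)),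
      cs.countP Shrunk.isConst ≤ 1 ∧
      cs.countP Shrunk.isAdd ≤ 52 ∧
      cs.countP Shrunk.isMul ≤ 18 ∧
      V' = {α | ∀ c ∈ cs, Shrunk.Sat q α c} ∧
      (∀ x ∈ V, ∃ y : Fin 70 → ℝ,
        (∀ j, y j ∈ Set.Icc (-(6 * q)) (6 * q)) ∧
        Sum.elim (fun i => q * x i) y ∈ V') ∧
      (∀ α ∈ V', (fun i : Fin 4 => q⁻¹ * α (Sum.inl i)) ∈ V) := by
  obtain ⟨e⟩ : Nonempty (κ ↪ Fin 70) :=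
    Function.Embedding.nonempty_of_card_le (by simpa using hκ)
  refine ⟨cs.map (Shrunk.map (Sum.map id e)), _, ?_, ?_, ?_, rfl, fun x hx => ?_,
    fun α hα => ?_⟩
  · rwa [List.countP_map, Shrunk.isConst_comp_map]
  · rwa [List.countP_map, Shrunk.isAdd_comp_map]
  · rwa [List.countP_map, Shrunk.isMul_comp_map]
  · obtain ⟨y, hy, hsat⟩ := hcomplete x hx
    refine ⟨Function.extend e y 0, fun j => ?_, ?_⟩
    · by_cases hj : ∃ k, e k = j
      · obtain ⟨k, rfl⟩ := hj
        rw [e.injective.extend_apply]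
        exact hy k
      · rw [Function.extend_apply' _ _ _ hj]
        constructor <;> simp only [Pi.zero_apply] <;> linarith
    · simp only [Set.mem_ofPred_eq, List.forall_mem_map, Shrunk.sat_map, Sum.elim_comp_map,
        Function.comp_id, Function.extend_comp e.injective]
      exact hsat
  · simp only [Set.mem_ofPred_eq, List.forall_mem_map, Shrunk.sat_map] at hα
    exact hsound _ hα

/-- Auxiliary variables shared by all coordinates: `q`, `0`, and multiples of the reduced scale
`q / (1 + q)`. -/
inductive GlobalAux : Type where
  | unit | zero | negScale | scale | half | double
  deriving DecidableEq

instance : Fintype GlobalAux where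
  elems := {.unit, .zero, .negScale, .scale, .half, .double}
  complete x := by cases x <;> decide

/-- Auxiliary variables confining one coordinate to its interval. -/
inductive BoxAux : Type where
  | shifted | scaled | upper | lower | root | square | sum | sumProd | rootSum | rootSumProd
  deriving DecidableEq

instance : Fintype BoxAux where
  elems := {.shifted, .scaled, .upper, .lower, .root, .square, .sum, .sumProd, .rootSum, .rootSumProd}
  complete x := by cases x <;> decide

/-- Auxiliary variables for an equality between two products. -/
inductive RelationAux : Type where
  | value | leftSum | leftSumProd | rightSum | rightSumProd
  deriving DecidableEq

instance : Fintype RelationAux where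
  elems := {.value, .leftSum, .leftSumProd, .rightSum, .rightSumProd}
  complete x := by cases x <;> decide

abbrev ShrinkAux : Type := GlobalAux ⊕ (Fin 4 × BoxAux) ⊕ RelationAux

abbrev ShrinkVar : Type := Fin 4 ⊕ ShrinkAux

namespace ShrinkVar

abbrev coord (i : Fin 4) : ShrinkVar := .inl i

abbrev global (g : GlobalAux) : ShrinkVar := .inr (.inl g)

abbrev box (i : Fin 4) (b : BoxAux) : ShrinkVar := .inr (.inr (.inl (i, b)))

abbrev rel (r : RelationAux) : ShrinkVar := .inr (.inr (.inr r))

end ShrinkVar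

open ShrinkVar

/-- The reduced scale `q / (1 + q)`, which is at most `q` and at most `1`. -/
noncomputable def reducedScale (q : ℝ) : ℝ := q / (1 + q)

theorem reducedScale_pos {q : ℝ} (hq : 0 < q) : 0 < reducedScale q := by
  unfold reducedScale; positivity

theorem reducedScale_mul_one_add {q : ℝ} (hq : 0 < q) : reducedScale q * (1 + q) = q := by
  unfold reducedScale; field_simp

theorem reducedScale_le {q : ℝ} (hq : 0 < q) : reducedScale q ≤ q := by
  nlinarith [reducedScale_mul_one_add hq, reducedScale_pos hq]

theorem reducedScale_mul_mem_Icc {q k : ℝ} (hq : 0 < q)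
    (hk : |k| ≤ 6 * (1 + reducedScale q)) :
    reducedScale q * k ∈ Set.Icc (-(6 * q)) (6 * q) := by
  rw [Set.mem_Icc, ← abs_le, abs_mul, abs_of_pos (reducedScale_pos hq)]
  nlinarith [mul_le_mul_of_nonneg_left hk (reducedScale_pos hq).le, reducedScale_le hq,
    reducedScale_mul_one_add hq, reducedScale_pos hq]

def globalConstraints : List (Shrunk ShrinkVar) :=
  [.const (global .unit),
   .add (global .zero) (global .zero) (global .zero),
   .mul (global .unit) (global .negScale) (global .zero),
   .add (global .negScale) (global .scale) (global .zero),
   .add (global .half) (global .half) (global .scale),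
   .add (global .scale) (global .scale) (global .double)]

/-- With `v = q⁻¹ * α (coord i)` and `δ = reducedScale q`, these say that `box i .scaled` is `δ * v`
and that `δ * (2 - v) * (δ * (v - 1 / 2))` is a square. -/
def boxConstraints (i : Fin 4) : List (Shrunk ShrinkVar) :=
  [.mul (coord i) (global .negScale) (box i .shifted),
   .add (box i .shifted) (global .scale) (box i .scaled),
   .add (box i .upper) (box i .scaled) (global .double),
   .add (box i .lower) (global .half) (box i .scaled)] ++
  Shrunk.product (box i .upper) (box i .lower) (box i .square) (box i .sum) (box i .sumProd) ++
  Shrunk.product (box i .root) (box i .root) (box i .square) (box i .rootSum)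
    (box i .rootSumProd)

def baseConstraints : List (Shrunk ShrinkVar) :=
  globalConstraints ++ (List.finRange 4).flatMap boxConstraints

/-- The ratios of the shared auxiliary variables to the reduced scale. -/
noncomputable def globalValue (q : ℝ) : GlobalAux → ℝ
  | .unit => 1 + q
  | .zero => 0
  | .negScale => -1
  | .scale => 1
  | .half => 1 / 2
  | .double => 2

/-- The ratios of the auxiliary variables of a coordinate `t` to the reduced scale. -/
noncomputable def boxValue (q t : ℝ) : BoxAux → ℝ
  | .shifted => t - 1
  | .scaled => t
  | .upper => 2 - t
  | .lower => t - 1 / 2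
  | .root => √((2 - t) * (t - 1 / 2))
  | .square => reducedScale q * ((2 - t) * (t - 1 / 2))
  | .sum => 3 / 2
  | .sumProd => reducedScale q * ((2 - t) * (t - 1 / 2)) + 3 / 2
  | .rootSum => 2 * √((2 - t) * (t - 1 / 2))
  | .rootSumProd =>
      reducedScale q * ((2 - t) * (t - 1 / 2)) + 2 * √((2 - t) * (t - 1 / 2))

noncomputable def shrinkAuxValue (q : ℝ) (v : Fin 4 → ℝ) (y : RelationAux → ℝ) : ShrinkAux → ℝ :=
  Sum.elim (fun g => reducedScale q * globalValue q g)
    (Sum.elim (fun p => reducedScale q * boxValue q (v p.1) p.2) y)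

noncomputable def shrinkVarValue (q : ℝ) (v : Fin 4 → ℝ) (y : RelationAux → ℝ) : ShrinkVar → ℝ :=
  Sum.elim (fun i => q * v i) (shrinkAuxValue q v y)

theorem globalValue_mem_Icc {q : ℝ} (hq : 0 < q) (g : GlobalAux) :
    reducedScale q * globalValue q g ∈ Set.Icc (-(6 * q)) (6 * q) := by
  have hδ := reducedScale_pos hq
  cases g
  case unit =>
    rw [globalValue, reducedScale_mul_one_add hq]
    constructor <;> linarith
  all_goals
    apply reducedScale_mul_mem_Icc hq
    rw [abs_le]
    constructor <;> simp only [globalValue] <;> linarith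

theorem boxValue_mem_Icc {q t : ℝ} (hq : 0 < q) (ht : t ∈ Set.Icc (1 / 2 : ℝ) 2) (b : BoxAux) :
    reducedScale q * boxValue q t b ∈ Set.Icc (-(6 * q)) (6 * q) := by
  obtain ⟨h₁, h₂⟩ := ht
  have hδ := reducedScale_pos hq
  have hm₀ : 0 ≤ (2 - t) * (t - 1 / 2) := mul_nonneg (by linarith) (by linarith)
  have hm₁ : (2 - t) * (t - 1 / 2) ≤ 1 := by nlinarith [sq_nonneg (t - 5 / 4)]
  have hr₀ := Real.sqrt_nonneg ((2 - t) * (t - 1 / 2))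
  have hr₁ : √((2 - t) * (t - 1 / 2)) ≤ 1 := Real.sqrt_le_one.2 hm₁
  have hs₀ := mul_nonneg hδ.le hm₀
  have hs₁ := mul_le_mul_of_nonneg_left hm₁ hδ.le
  apply reducedScale_mul_mem_Icc hq
  rw [abs_le]
  cases b <;> constructor <;> simp only [boxValue] <;> linarith

theorem forall_mem_baseConstraints_sat {q : ℝ} (hq : 0 < q) {v : Fin 4 → ℝ}
    (hv : ∀ i, v i ∈ Set.Icc (1 / 2 : ℝ) 2) (y : RelationAux → ℝ) :
    ∀ c ∈ baseConstraints, c.Sat q (shrinkVarValue q v y) := by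
  have hδ := reducedScale_mul_one_add hq
  simp only [baseConstraints, List.forall_mem_append, List.mem_flatMap, List.mem_finRange,
    true_and, forall_exists_index]
  refine ⟨?_, fun c i hc => ?_⟩
  · simp only [globalConstraints, List.forall_mem_cons, List.not_mem_nil, false_imp_iff,
      implies_true, and_true, Shrunk.Sat, shrinkVarValue, shrinkAuxValue, Sum.elim_inl,
      Sum.elim_inr, globalValue]
    refine ⟨hδ, by ring, ?_, by ring, by ring, by ring⟩
    linear_combination (1 - reducedScale q) * hδ - hδ
  · revert c
    simp only [boxConstraints, List.forall_mem_append, Shrunk.forall_mem_product_sat]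
    have hr := Real.mul_self_sqrt
      (mul_nonneg (sub_nonneg.2 (hv i).2) (sub_nonneg.2 (hv i).1))
    simp only [List.forall_mem_cons, List.not_mem_nil, false_imp_iff,
      implies_true, and_true, Shrunk.Sat, shrinkVarValue, shrinkAuxValue, Sum.elim_inl,
      Sum.elim_inr, globalValue, boxValue]
    refine ⟨⟨⟨?_, ?_, ?_, ?_⟩, ?_, ?_, ?_⟩, ?_, ?_, ?_⟩
    · linear_combination -v i * hδ
    all_goals first
      | ring1
      | linear_combination -(reducedScale q) ^ 2 * hr

theorem baseConstraints_sound {q : ℝ} (hq : 0 < q) {α : ShrinkVar → ℝ}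
    (hα : ∀ c ∈ baseConstraints, c.Sat q α) :
    α (global .zero) = 0 ∧ α (global .negScale) = -reducedScale q ∧
      α (global .scale) = reducedScale q ∧
      (∀ i, α (box i .scaled) = reducedScale q * (q⁻¹ * α (coord i))) ∧
      ∀ i, q⁻¹ * α (coord i) ∈ Set.Icc (1 / 2 : ℝ) 2 := by
  have hδ := reducedScale_mul_one_add hq
  have hδ₀ := reducedScale_pos hq
  simp only [baseConstraints, List.forall_mem_append, List.mem_flatMap, List.mem_finRange,
    true_and, forall_exists_index] at hα
  obtain ⟨hglobal, hbox⟩ := hα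
  simp only [globalConstraints, List.forall_mem_cons, List.not_mem_nil, false_imp_iff,
    implies_true, and_true, Shrunk.Sat] at hglobal
  obtain ⟨hunit, hzero, hneg, hscale, hhalf, hdouble⟩ := hglobal
  have hzero : α (global .zero) = 0 := by linarith
  have hneg : α (global .negScale) = -reducedScale q := by
    rw [hunit, hzero] at hneg
    have : (1 + q) ≠ 0 := by positivity
    apply mul_left_cancel₀ this
    linarith
  have hscale : α (global .scale) = reducedScale q := by linarith
  have hcoord (i : Fin 4) : α (box i .scaled) = reducedScale q * (q⁻¹ * α (coord i)) ∧
      q⁻¹ * α (coord i) ∈ Set.Icc (1 / 2 : ℝ) 2 := by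
    have h := fun c => hbox c i
    simp only [boxConstraints, List.forall_mem_append, Shrunk.forall_mem_product_sat] at h
    simp only [List.forall_mem_cons, List.not_mem_nil, false_imp_iff,
      implies_true, and_true, Shrunk.Sat] at h
    obtain ⟨⟨⟨hshift, hscaled, hupper, hlower⟩, -, -, hprod⟩, -, -, hroot⟩ := h
    set t := q⁻¹ * α (coord i) with ht
    have hx : α (coord i) = q * t := by rw [ht]; field_simp
    have hβ : α (box i .scaled) = reducedScale q * t := by
      rw [hx, hneg] at hshift
      linear_combination -hscaled - hshift + hscale - t * hδ
    refine ⟨hβ, ?_⟩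
    have hup : α (box i .upper) = reducedScale q * (2 - t) := by linarith
    have hlow : α (box i .lower) = reducedScale q * (t - 1 / 2) := by linarith
    have hnonneg : 0 ≤ reducedScale q ^ 2 * ((2 - t) * (t - 1 / 2)) := by
      rw [hup, hlow] at hprod
      nlinarith [mul_self_nonneg (α (box i .root))]
    have hnonneg := nonneg_of_mul_nonneg_right hnonneg (by positivity)
    constructor <;> nlinarith
  exact ⟨hzero, hneg, hscale, fun i => (hcoord i).1, fun i => (hcoord i).2⟩

/-- A relation on the box `[1/2, 2]^4` can be shrunk if it is expressed by at most `20` additive and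
`5` multiplicative constraints in the coordinates and the reduced scale. -/
theorem exists_shrunk_of_relation {q : ℝ} (hq : 0 < q) (P : (Fin 4 → ℝ) → Prop)
    (E : List (Shrunk ShrinkVar)) (hconst : E.countP Shrunk.isConst = 0)
    (hadd : E.countP Shrunk.isAdd ≤ 20) (hmul : E.countP Shrunk.isMul ≤ 5)
    (hcomplete : ∀ v : Fin 4 → ℝ, (∀ i, v i ∈ Set.Icc (1 / 2 : ℝ) 2) → P v →
      ∃ y : RelationAux → ℝ, (∀ j, y j ∈ Set.Icc (-(6 * q)) (6 * q)) ∧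
        ∀ c ∈ E, c.Sat q (shrinkVarValue q v y))
    (hsound : ∀ α : ShrinkVar → ℝ, α (global .zero) = 0 →
      α (global .negScale) = -reducedScale q → α (global .scale) = reducedScale q →
      (∀ i, α (box i .scaled) = reducedScale q * (q⁻¹ * α (coord i))) →
      (∀ c ∈ E, c.Sat q α) → P (fun i => q⁻¹ * α (coord i))) :
    ∃ (cs : List (Shrunk (Fin 4 ⊕ Fin 70))) (V' : Set ((Fin 4 ⊕ Fin 70) → ℝ)),
      cs.countP Shrunk.isConst ≤ 1 ∧
      cs.countP Shrunk.isAdd ≤ 52 ∧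
      cs.countP Shrunk.isMul ≤ 18 ∧
      V' = {α | ∀ c ∈ cs, Shrunk.Sat q α c} ∧
      (∀ x ∈ {v : Fin 4 → ℝ | (∀ i, v i ∈ Set.Icc (1 / 2 : ℝ) 2) ∧ P v}, ∃ y : Fin 70 → ℝ,
        (∀ j, y j ∈ Set.Icc (-(6 * q)) (6 * q)) ∧
        Sum.elim (fun i => q * x i) y ∈ V') ∧
      (∀ α ∈ V', (fun i : Fin 4 => q⁻¹ * α (Sum.inl i)) ∈
        {v : Fin 4 → ℝ | (∀ i, v i ∈ Set.Icc (1 / 2 : ℝ) 2) ∧ P v}) := by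
  have hbase_const : baseConstraints.countP Shrunk.isConst = 1 := by decide
  have hbase_add : baseConstraints.countP Shrunk.isAdd = 32 := by decide
  have hbase_mul : baseConstraints.countP Shrunk.isMul = 13 := by decide
  refine exists_shrunk_of_card_le (κ := ShrinkAux) (by decide) hq (baseConstraints ++ E)
    ?_ ?_ ?_ ?_ ?_
  · rw [List.countP_append]; omega
  · rw [List.countP_append]; omega
  · rw [List.countP_append]; omega
  · rintro v ⟨hv, hP⟩
    obtain ⟨y, hy, hE⟩ := hcomplete v hv hP
    refine ⟨shrinkAuxValue q v y, ?_,
      List.forall_mem_append.2 ⟨forall_mem_baseConstraints_sat hq hv y, hE⟩⟩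
    rintro (g | ⟨i, b⟩ | r)
    · exact globalValue_mem_Icc hq g
    · exact boxValue_mem_Icc hq (hv i) b
    · exact hy r
  · intro α hα
    obtain ⟨hα, hE⟩ := List.forall_mem_append.1 hα
    obtain ⟨hzero, hneg, hscale, hscaled, hIcc⟩ := baseConstraints_sound hq hα
    exact ⟨hIcc, hsound α hzero hneg hscale hscaled hE⟩

/-- Constraints expressing `α a * α b = α c * α d`. -/
def equalProducts (a b c d : ShrinkVar) : List (Shrunk ShrinkVar) :=
  Shrunk.product a b (rel .value) (rel .leftSum) (rel .leftSumProd) ++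
    Shrunk.product c d (rel .value) (rel .rightSum) (rel .rightSumProd)

theorem mul_eq_mul_of_equalProducts_sat {q : ℝ} {α : ShrinkVar → ℝ} {a b c d : ShrinkVar}
    (h : ∀ k ∈ equalProducts a b c d, k.Sat q α) : α a * α b = α c * α d := by
  simp only [equalProducts, List.forall_mem_append, Shrunk.forall_mem_product_sat] at h
  rw [← h.1.2.2, h.2.2.2]

/-- The auxiliary values for an equality between the products of `δ * a`, `δ * b` and of `δ * c`,
`δ * d`, where `δ` is the reduced scale, as multiples of `δ`. -/
noncomputable def relationValue (q a b c d : ℝ) : RelationAux → ℝ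
  | .value => reducedScale q * (a * b)
  | .leftSum => a + b
  | .leftSumProd => reducedScale q * (a * b) + (a + b)
  | .rightSum => c + d
  | .rightSumProd => reducedScale q * (a * b) + (c + d)

theorem relationValue_mem_Icc {q a b c d : ℝ} (hq : 0 < q) (ha : a ∈ Set.Icc (1 / 2 : ℝ) 2)
    (hb : b ∈ Set.Icc (1 / 2 : ℝ) 2) (hc : c ∈ Set.Icc (1 / 2 : ℝ) 2)
    (hd : d ∈ Set.Icc (1 / 2 : ℝ) 2) (r : RelationAux) :
    reducedScale q * relationValue q a b c d r ∈ Set.Icc (-(6 * q)) (6 * q) := by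
  obtain ⟨ha₁, ha₂⟩ := ha
  obtain ⟨hb₁, hb₂⟩ := hb
  obtain ⟨hc₁, hc₂⟩ := hc
  obtain ⟨hd₁, hd₂⟩ := hd
  have hδ := reducedScale_pos hq
  have h₀ : 0 ≤ reducedScale q * (a * b) :=
    mul_nonneg hδ.le (mul_nonneg (by linarith) (by linarith))
  have h₁ : reducedScale q * (a * b) ≤ reducedScale q * 4 :=
    mul_le_mul_of_nonneg_left (by nlinarith) hδ.le
  apply reducedScale_mul_mem_Icc hq
  rw [abs_le]
  cases r <;> constructor <;> simp only [relationValue] <;> linarith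

/-- The values `relationValue` satisfy the constraints of an equality between two products. -/
theorem forall_mem_equalProducts_sat {q : ℝ} {v : Fin 4 → ℝ} {a b c d : ℝ}
    (h : a * b = c * d) {i j k l : ShrinkVar} {α : ShrinkVar → ℝ}
    (hα : α = shrinkVarValue q v (fun r => reducedScale q * relationValue q a b c d r))
    (hi : α i = reducedScale q * a) (hj : α j = reducedScale q * b)
    (hk : α k = reducedScale q * c) (hl : α l = reducedScale q * d) :
    ∀ e ∈ equalProducts i j k l, e.Sat q α := by
  have hrel (r : RelationAux) : α (rel r) = reducedScale q * relationValue q a b c d r := by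
    rw [hα]; rfl
  simp only [equalProducts, List.forall_mem_append, Shrunk.forall_mem_product_sat, hrel, hi, hj,
    hk, hl, relationValue]
  refine ⟨⟨by ring, by ring, by ring⟩, by ring, by ring, ?_⟩
  linear_combination reducedScale q ^ 2 * h

/-- each constraint `V ∈ 𝒞(q)` can be shrunk: there is
`V′ ⊆ ℝ^{74} = ℝ^{4+70}` cut out by at most `1` constraint `αᵢ = q`, at most `52`
constraints `αᵢ + αⱼ = α_k` and at most `18` constraints `(1+αᵢ)(1+αⱼ) = 1+α_k`, such
that every `x ∈ V` extends to some `(q·x, y) ∈ V′` with `y ∈ [−6q, 6q]^{70}`, and every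
`(x, y) ∈ V′` has `q⁻¹·x ∈ V`. -/
theorem constraint_shrinking (q : ℝ) (hq : 0 < q)
    (V : Set (Fin 4 → ℝ)) (hV : V ∈ CqSets q) :
    ∃ (cs : List (Shrunk (Fin 4 ⊕ Fin 70))) (V' : Set ((Fin 4 ⊕ Fin 70) → ℝ)),
      cs.countP Shrunk.isConst ≤ 1 ∧
      cs.countP Shrunk.isAdd ≤ 52 ∧
      cs.countP Shrunk.isMul ≤ 18 ∧
      V' = {α | ∀ c ∈ cs, Shrunk.Sat q α c} ∧
      (∀ x ∈ V, ∃ y : Fin 70 → ℝ,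
        (∀ j, y j ∈ Set.Icc (-(6 * q)) (6 * q)) ∧
        Sum.elim (fun i => q * x i) y ∈ V') ∧
      (∀ α ∈ V', (fun i : Fin 4 => q⁻¹ * α (Sum.inl i)) ∈ V) := by
  have hδ := reducedScale_pos hq
  have hδq := reducedScale_mul_one_add hq
  have hq_bound {k : ℝ} (h₀ : 0 ≤ k) (h₄ : k ≤ 6) : q * k ∈ Set.Icc (-(6 * q)) (6 * q) := by
    constructor <;> nlinarith
  have hone : (1 : ℝ) ∈ Set.Icc (1 / 2 : ℝ) 2 := by norm_num
  rcases hV with rfl | rfl | rfl | rfl | rfl | rfl | rfl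
  · refine exists_shrunk_of_relation hq (fun v => v 0 = v 1)
      [.add (coord 0) (global .zero) (coord 1)] (by decide) (by decide) (by decide) ?_ ?_
    · intro v hv hP
      refine ⟨fun _ => q * 0, fun _ => hq_bound (by norm_num) (by norm_num), ?_⟩
      simp [Shrunk.Sat, shrinkVarValue, shrinkAuxValue, globalValue, hP]
    · intro α hzero _ _ _ hE
      have h : α (coord 0) + α (global .zero) = α (coord 1) := by simpa [Shrunk.Sat] using hE
      simp only [← h, hzero, add_zero]
  · refine exists_shrunk_of_relation hq (fun v => v 0 = (1 + q) * v 1)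
      [.add (global .negScale) (box 1 .scaled) (rel .value),
        .mul (global .negScale) (box 0 .scaled) (rel .value)]
      (by decide) (by decide) (by decide) ?_ ?_
    · intro v hv hP
      refine ⟨fun _ => reducedScale q * (v 1 - 1), fun _ => reducedScale_mul_mem_Icc hq ?_, ?_⟩
      · rw [abs_le]
        constructor <;> linarith [(hv 1).1, (hv 1).2]
      · simp only [List.forall_mem_cons, List.not_mem_nil, false_imp_iff, implies_true, and_true,
          Shrunk.Sat, shrinkVarValue, shrinkAuxValue, Sum.elim_inl, Sum.elim_inr, globalValue,
          boxValue, hP]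
        refine ⟨by ring, ?_⟩
        linear_combination -reducedScale q * v 1 * hδq
    · intro α _ hneg _ hscaled hE
      simp only [List.forall_mem_cons, List.not_mem_nil, false_imp_iff, implies_true, and_true,
          Shrunk.Sat, hneg, hscaled] at hE
      obtain ⟨h₁, h₂⟩ := hE
      apply mul_left_cancel₀ hδ.ne'
      linear_combination (1 + q) * h₂ - (1 + q) * h₁ +
        reducedScale q * (q⁻¹ * α (coord 0)) * hδq
  · refine exists_shrunk_of_relation hq (fun v => v 0 + v 1 = v 2)
      [.add (coord 0) (coord 1) (coord 2)] (by decide) (by decide) (by decide) ?_ ?_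
    · intro v hv hP
      refine ⟨fun _ => q * 0, fun _ => hq_bound (by norm_num) (by norm_num), ?_⟩
      simp [Shrunk.Sat, shrinkVarValue, ← hP, mul_add]
    · intro α _ _ _ _ hE
      have h : α (coord 0) + α (coord 1) = α (coord 2) := by simpa [Shrunk.Sat] using hE
      simp only [← h, mul_add]
  · refine exists_shrunk_of_relation hq (fun v => v 0 + v 1 = v 2 + v 3)
      [.add (coord 0) (coord 1) (rel .value), .add (coord 2) (coord 3) (rel .value)]
      (by decide) (by decide) (by decide) ?_ ?_
    · intro v hv hP
      refine ⟨fun _ => q * (v 0 + v 1), fun _ => hq_bound ?_ ?_, ?_⟩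
      · linarith [(hv 0).1, (hv 1).1]
      · linarith [(hv 0).2, (hv 1).2]
      · simp [Shrunk.Sat, shrinkVarValue, shrinkAuxValue, hP, ← mul_add]
    · intro α _ _ _ _ hE
      have h : α (coord 0) + α (coord 1) = α (rel .value) ∧
          α (coord 2) + α (coord 3) = α (rel .value) := by simpa [Shrunk.Sat] using hE
      simp only [← mul_add, h.1, h.2]
  · refine exists_shrunk_of_relation hq (fun v => v 0 * v 1 = v 2)
      (equalProducts (box 0 .scaled) (box 1 .scaled) (box 2 .scaled) (global .scale))
      (by decide) (by decide) (by decide) ?_ ?_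
    · intro v hv hP
      exact ⟨_, relationValue_mem_Icc hq (hv 0) (hv 1) (hv 2) hone,
        forall_mem_equalProducts_sat (by rw [hP, mul_one]) rfl rfl rfl rfl rfl⟩
    · intro α _ _ hscale hscaled hE
      have h := mul_eq_mul_of_equalProducts_sat hE
      simp only [hscale, hscaled] at h
      apply mul_left_cancel₀ (pow_ne_zero 2 hδ.ne')
      linear_combination h
  · refine exists_shrunk_of_relation hq (fun v => v 0 * v 1 = v 2 * v 3)
      (equalProducts (box 0 .scaled) (box 1 .scaled) (box 2 .scaled) (box 3 .scaled))
      (by decide) (by decide) (by decide) ?_ ?_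
    · intro v hv hP
      exact ⟨_, relationValue_mem_Icc hq (hv 0) (hv 1) (hv 2) (hv 3),
        forall_mem_equalProducts_sat hP rfl rfl rfl rfl rfl⟩
    · intro α _ _ _ hscaled hE
      have h := mul_eq_mul_of_equalProducts_sat hE
      simp only [hscaled] at h
      apply mul_left_cancel₀ (pow_ne_zero 2 hδ.ne')
      linear_combination h
  · have h := exists_shrunk_of_relation hq (fun _ => True) [] (by decide) (by decide) (by decide)
      (fun v _ _ => ⟨fun _ => q * 0, fun _ => hq_bound (by norm_num) (by norm_num), by simp⟩)
      (fun _ _ _ _ _ _ => trivial)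
    simpa only [and_true] using h
end
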